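/- arXiv:2303.04892 — 5 statements merged into one kernel-verified Lean document; each statement's English description precedes it below -/
import Mathlib

section
/- Let 𝕜 be ℝ or ℂ, let ϵ > 0, and let ε = (ϵ,…,ϵ) be the constant vector of length n−1. Then g[CP_n(𝕜)] ≥ g[CP^ε_n(𝕜)] / (1 + ϵ(2+ϵ)·g[CP^ε_{n−1}(𝕜)] + ϵ·Σ_{i=1}^{n−2} g[CP^ε_i(𝕜)]), where CP^ε_m(𝕜) for m < n uses the constant vector (ϵ,…,ϵ) of length m−1. -/
open scoped BigOperators

/-- `geIter A k` is the Gaussian elimination iterate `A^{(k+1)}` (0-indexed, `geIter A 0 = A`).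
Entries with row or column index `< k` are left unchanged; they are irrelevant. -/
noncomputable def geIter {𝕜 : Type*} [Field 𝕜] {n : ℕ} (A : Matrix (Fin n) (Fin n) 𝕜) :
    ℕ → Matrix (Fin n) (Fin n) 𝕜
  | 0 => A
  | k + 1 => fun i j =>
    if h : k < n ∧ k + 1 ≤ i.1 ∧ k + 1 ≤ j.1 then
      geIter A k i j -
        geIter A k i ⟨k, h.1⟩ * geIter A k ⟨k, h.1⟩ j / geIter A k ⟨k, h.1⟩ ⟨k, h.1⟩
    else geIter A k i j

/-- The norm of the pivot `a^{(k+1)}_{k,k}` (0-indexed). -/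
noncomputable def pivotNorm {𝕜 : Type*} [RCLike 𝕜] {n : ℕ}
    (A : Matrix (Fin n) (Fin n) 𝕜) (k : ℕ) : ℝ :=
  if h : k < n then ‖geIter A k ⟨k, h⟩ ⟨k, h⟩‖ else 0

/-- The growth factor `g(A)`. -/
noncomputable def growth {𝕜 : Type*} [RCLike 𝕜] {n : ℕ} (A : Matrix (Fin n) (Fin n) 𝕜) : ℝ :=
  (⨆ k : Fin n, ⨆ i : Fin n, ⨆ j : Fin n,
      if k.1 ≤ i.1 ∧ k.1 ≤ j.1 then ‖geIter A k.1 i j‖ else 0) /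
    ⨆ i : Fin n, ⨆ j : Fin n, ‖A i j‖

/-- `A` is completely pivoted: `A ∈ CP_n(𝕜)`. -/
def IsCP {𝕜 : Type*} [RCLike 𝕜] {n : ℕ} (A : Matrix (Fin n) (Fin n) 𝕜) : Prop :=
  A.det ≠ 0 ∧ (∀ k : ℕ, k + 1 < n → pivotNorm A k ≠ 0) ∧
    ∀ (k : ℕ) (i j : Fin n), k ≤ i.1 → k ≤ j.1 → ‖geIter A k i j‖ ≤ pivotNorm A k

/-- `g[CP_n(𝕜)]`. -/
noncomputable def gCP (𝕜 : Type*) [RCLike 𝕜] (n : ℕ) : ℝ :=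
  sSup (growth '' {A : Matrix (Fin n) (Fin n) 𝕜 | IsCP A})

/-- `A ∈ CP^ε_n(𝕜)`: almost completely pivoted with tolerance `ε k` at step `k`
(0-indexed, so `ε 0` is the paper's `ε_1`). -/
def IsCPeps {𝕜 : Type*} [RCLike 𝕜] {n : ℕ} (ε : ℕ → ℝ)
    (A : Matrix (Fin n) (Fin n) 𝕜) : Prop :=
  A.det ≠ 0 ∧ (∀ k : ℕ, k + 1 < n → pivotNorm A k ≠ 0) ∧
    ∀ (k : ℕ) (i j : Fin n), k ≤ i.1 → k ≤ j.1 → ¬(i.1 = k ∧ j.1 = k) →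
      ‖geIter A k i j‖ ≤ (1 + ε k) * pivotNorm A k

/-- `g[CP^ε_n(𝕜)]` for the constant tolerance vector `ε = (ϵ,...,ϵ)`. -/
noncomputable def gCPeps (𝕜 : Type*) [RCLike 𝕜] (n : ℕ) (ϵ : ℝ) : ℝ :=
  sSup (growth '' {A : Matrix (Fin n) (Fin n) 𝕜 | IsCPeps (fun _ => ϵ) A})


section helpers

variable {𝕜 : Type*} [RCLike 𝕜]

/-- The largest modulus of an entry. -/
noncomputable def mxN {n : ℕ} (A : Matrix (Fin n) (Fin n) 𝕜) : ℝ := ⨆ i : Fin n, ⨆ j : Fin n, ‖A i j‖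

/-- The largest modulus over all iterates. -/
noncomputable def numN {n : ℕ} (A : Matrix (Fin n) (Fin n) 𝕜) : ℝ :=
  ⨆ k : Fin n, ⨆ i : Fin n, ⨆ j : Fin n,
      if k.1 ≤ i.1 ∧ k.1 ≤ j.1 then ‖geIter A k.1 i j‖ else 0

lemma growth_eq {n : ℕ} (A : Matrix (Fin n) (Fin n) 𝕜) : growth A = numN A / mxN A := rfl

lemma le_mxN {n : ℕ} (A : Matrix (Fin n) (Fin n) 𝕜) (i j : Fin n) : ‖A i j‖ ≤ mxN A :=
  (le_ciSup (f := fun j => ‖A i j‖) (Set.finite_range _).bddAbove j).trans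
    (le_ciSup (f := fun i => ⨆ j, ‖A i j‖) (Set.finite_range _).bddAbove i)

lemma mxN_le {n : ℕ} (A : Matrix (Fin n) (Fin n) 𝕜) {c : ℝ} (hc : 0 ≤ c)
    (h : ∀ i j, ‖A i j‖ ≤ c) : mxN A ≤ c :=
  Real.iSup_le (fun i => Real.iSup_le (fun j => h i j) hc) hc

lemma mxN_nonneg {n : ℕ} (A : Matrix (Fin n) (Fin n) 𝕜) : 0 ≤ mxN A :=
  Real.iSup_nonneg fun _ => Real.iSup_nonneg fun _ => norm_nonneg _

lemma le_numN {n : ℕ} (A : Matrix (Fin n) (Fin n) 𝕜) (k : ℕ) (i j : Fin n) (hi : k ≤ i.1)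
    (hj : k ≤ j.1) : ‖geIter A k i j‖ ≤ numN A := by
  have hk : k < n := lt_of_le_of_lt hi i.2
  let f : Fin n → Fin n → Fin n → ℝ := fun k i j =>
    if k.1 ≤ i.1 ∧ k.1 ≤ j.1 then ‖geIter A k.1 i j‖ else 0
  have h0 : ‖geIter A k i j‖ = f ⟨k, hk⟩ i j := (if_pos (⟨hi, hj⟩ : k ≤ i.1 ∧ k ≤ j.1)).symm
  rw [h0]
  exact ((le_ciSup (f := fun j => f ⟨k, hk⟩ i j) (Set.finite_range _).bddAbove j).trans
    (le_ciSup (f := fun i => ⨆ j, f ⟨k, hk⟩ i j) (Set.finite_range _).bddAbove i)).trans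
    (le_ciSup (f := fun k => ⨆ i, ⨆ j, f k i j) (Set.finite_range _).bddAbove ⟨k, hk⟩)

lemma numN_le {n : ℕ} (A : Matrix (Fin n) (Fin n) 𝕜) {c : ℝ} (hc : 0 ≤ c)
    (h : ∀ (k : ℕ) (i j : Fin n), k ≤ i.1 → k ≤ j.1 → ‖geIter A k i j‖ ≤ c) : numN A ≤ c := by
  refine Real.iSup_le (fun k => Real.iSup_le (fun i => Real.iSup_le (fun j => ?_) hc) hc) hc
  split_ifs with hh
  · exact h _ _ _ hh.1 hh.2
  · exact hc

lemma numN_nonneg {n : ℕ} (A : Matrix (Fin n) (Fin n) 𝕜) : 0 ≤ numN A := by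
  refine Real.iSup_nonneg fun _ => Real.iSup_nonneg fun _ => Real.iSup_nonneg fun _ => ?_
  split_ifs
  · exact norm_nonneg _
  · exact le_rfl

lemma growth_nonneg {n : ℕ} (A : Matrix (Fin n) (Fin n) 𝕜) : 0 ≤ growth A := by
  rw [growth_eq]; exact div_nonneg (numN_nonneg A) (mxN_nonneg A)

lemma pivotNorm_eq {n : ℕ} (A : Matrix (Fin n) (Fin n) 𝕜) (i : Fin n) :
    pivotNorm A i.1 = ‖geIter A i.1 i i‖ := by
  simp [pivotNorm, i.2]

lemma pivotNorm_nonneg {n : ℕ} (A : Matrix (Fin n) (Fin n) 𝕜) (k : ℕ) : 0 ≤ pivotNorm A k := by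
  unfold pivotNorm; split_ifs
  · exact norm_nonneg _
  · exact le_rfl

lemma geIter_raw {n : ℕ} (A : Matrix (Fin n) (Fin n) 𝕜) (k : ℕ) (i j : Fin n) :
    geIter A (k + 1) i j = if h : k < n ∧ k + 1 ≤ i.1 ∧ k + 1 ≤ j.1 then
      geIter A k i j -
        geIter A k i ⟨k, h.1⟩ * geIter A k ⟨k, h.1⟩ j / geIter A k ⟨k, h.1⟩ ⟨k, h.1⟩
    else geIter A k i j := rfl

lemma geIter_succ {n : ℕ} (A : Matrix (Fin n) (Fin n) 𝕜) (k i j : Fin n) (hi : k < i) (hj : k < j) :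
    geIter A (k.1 + 1) i j = geIter A k.1 i j - geIter A k.1 i k * geIter A k.1 k j /
      geIter A k.1 k k := by
  have h : k.1 < n ∧ k.1 + 1 ≤ i.1 ∧ k.1 + 1 ≤ j.1 := ⟨k.2, hi, hj⟩
  rw [geIter_raw, dif_pos h]

/-- Elimination writes `A` as a partial sum of rank-one terms plus the iterate. -/
lemma geIter_sum {n : ℕ} (A : Matrix (Fin n) (Fin n) 𝕜) (i j : Fin n) :
    ∀ m : ℕ, m ≤ i.1 → m ≤ j.1 →
      A i j = (∑ k : Fin n, if k.1 < m then geIter A k.1 i k * geIter A k.1 k j /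
      geIter A k.1 k k else 0) + geIter A m i j := by
  intro m
  induction m with
  | zero => intro _ _; simp [geIter]
  | succ m ih =>
    intro hi hj
    have hm : m < n := by omega
    rw [ih (by omega) (by omega), geIter_succ A ⟨m, hm⟩ i j hi hj]
    have : ∀ k : Fin n, (if k.1 < m + 1 then geIter A k.1 i k * geIter A k.1 k j /
        geIter A k.1 k k else 0) = (if k.1 < m then geIter A k.1 i k * geIter A k.1 k j /
        geIter A k.1 k k else 0) + if k = ⟨m, hm⟩ then geIter A k.1 i k * geIter A k.1 k j /
        geIter A k.1 k k else 0 := by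
      intro k
      rcases lt_trichotomy k.1 m with h | h | h
      · have h2 : k ≠ ⟨m, hm⟩ := by intro h3; rw [h3] at h; simp at h
        simp [h, h2, Nat.lt_succ_of_lt h]
      · have h2 : k = ⟨m, hm⟩ := Fin.ext h
        subst h2; simp
      · have h2 : k ≠ ⟨m, hm⟩ := by intro h3; rw [h3] at h; simp at h
        have h3 : ¬ k.1 < m + 1 := by omega
        have h4 : ¬ k.1 < m := by omega
        simp [h2, h3, h4]
    simp only [this, Finset.sum_add_distrib]
    simp only [Finset.sum_ite_eq', Finset.mem_univ, if_true]
    ring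

lemma det_eq {n : ℕ} (A : Matrix (Fin n) (Fin n) 𝕜)
    (hp : ∀ k : ℕ, k + 1 < n → pivotNorm A k ≠ 0) :
    A.det = ∏ i : Fin n, geIter A i.1 i i := by
  have hp' : ∀ i k : Fin n, k < i → geIter A k.1 k k ≠ 0 := by
    intro i k hk h0
    apply hp k.1 (by have := i.2; have : k.1 < i.1 := hk; omega)
    rw [pivotNorm_eq, h0, norm_zero]
  let L : Matrix (Fin n) (Fin n) 𝕜 := fun i k =>
    if i = k then 1 else if k < i then geIter A k.1 i k / geIter A k.1 k k else 0
  let U : Matrix (Fin n) (Fin n) 𝕜 := fun k j => if k ≤ j then geIter A k.1 k j else 0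
  have hA : A = L * U := by
    ext i j
    rw [Matrix.mul_apply]
    have hterm : ∀ k : Fin n, L i k * U k j =
        (if k.1 < min i.1 j.1 then geIter A k.1 i k * geIter A k.1 k j / geIter A k.1 k k else 0)
        + (if k = min i j then geIter A (min i.1 j.1) i j else 0) := by
      intro k
      by_cases hik : i = k
      · subst hik
        by_cases hij : i ≤ j
        · have h1 : min i j = i := min_eq_left hij
          have h2 : min i.1 j.1 = i.1 := min_eq_left hij
          simp [L, U, hij, h1, h2]
        · have hij' : j < i := not_le.mp hij
          have h1 : min i j = j := min_eq_right hij'.le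
          have h3 : i ≠ j := hij'.ne'
          simp [L, U, hij, h1, h3]
      · by_cases hki : k < i
        · by_cases hkj : k ≤ j
          · rcases hkj.lt_or_eq with h | h
            · have h1 : k ≠ min i j := (lt_min hki h).ne
              simp [L, U, hik, hki, hkj, h, h1]
              ring
            · subst h
              have h1 : min i k = k := min_eq_right hki.le
              have h2 : min i.1 k.1 = k.1 := min_eq_right hki.le
              have h3 := hp' i k hki
              simp [L, U, hik, hki, h1, h2]
              field_simp
          · have h1 : k ≠ min i j := by
              intro h; exact hkj (h ▸ min_le_right i j)
            have h4 : ¬ (k < j) := fun h => hkj h.le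
            simp [L, U, hik, hki, hkj, h1, h4]
        · have h1 : k ≠ min i j := by
            intro h
            have : k ≤ i := h ▸ min_le_left i j
            exact hki (lt_of_le_of_ne this (Ne.symm hik))
          simp [L, U, hik, hki, h1]
    rw [Finset.sum_congr rfl fun k _ => hterm k, Finset.sum_add_distrib]
    rw [geIter_sum A i j (min i.1 j.1) (min_le_left _ _) (min_le_right _ _)]
    simp
  conv_lhs => rw [hA]
  rw [Matrix.det_mul, Matrix.det_of_isLowerTriangular L, Matrix.det_of_isUpperTriangular]
  · simp [L, U]
  · intro i j hij
    have : j < i := hij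
    simp [U, this]
  · intro i j hij
    have : i < j := hij
    simp [L, this.ne, this.le]

lemma geIter_sub {m n : ℕ} (h : m ≤ n) (A : Matrix (Fin n) (Fin n) 𝕜) (k : ℕ) : ∀ (i j : Fin m),
    geIter (A.submatrix (Fin.castLE h) (Fin.castLE h)) k i j =
      geIter A k (Fin.castLE h i) (Fin.castLE h j) := by
  induction k with
  | zero => intro i j; rfl
  | succ k ih =>
    intro i j
    by_cases hh : k + 1 ≤ i.1 ∧ k + 1 ≤ j.1
    · have hkm : k < m := by have := i.2; omega
      rw [geIter_raw, dif_pos ⟨hkm, hh⟩, geIter_raw, dif_pos ⟨by omega, hh⟩]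
      simp only [ih]
      rfl
    · rw [geIter_raw, dif_neg (fun h => hh h.2), geIter_raw, dif_neg (fun h => hh h.2)]
      exact ih i j

lemma pivotNorm_sub {m n : ℕ} (h : m ≤ n) (A : Matrix (Fin n) (Fin n) 𝕜) (k : ℕ) (hk : k < m) :
    pivotNorm (A.submatrix (Fin.castLE h) (Fin.castLE h)) k = pivotNorm A k := by
  have hk' : k < n := by omega
  simp only [pivotNorm, hk, hk', dif_pos, geIter_sub]
  rfl

variable {ϵ : ℝ}

lemma pivot_ne {n : ℕ} {A : Matrix (Fin n) (Fin n) 𝕜} (hd : A.det ≠ 0)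
    (hp : ∀ k : ℕ, k + 1 < n → pivotNorm A k ≠ 0) (k : ℕ) (hk : k < n) : pivotNorm A k ≠ 0 := by
  rw [det_eq A hp, Finset.prod_ne_zero_iff] at hd
  have := hd ⟨k, hk⟩ (Finset.mem_univ _)
  simpa [pivotNorm, hk] using this

lemma sub_mem_eps {m n : ℕ} (h : m ≤ n) {A : Matrix (Fin n) (Fin n) 𝕜} (hA : IsCPeps (fun _ => ϵ) A) :
    IsCPeps (fun _ => ϵ) (A.submatrix (Fin.castLE h) (Fin.castLE h)) := by
  have hpA := pivot_ne hA.1 hA.2.1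
  have hp : ∀ k, k < m → pivotNorm (A.submatrix (Fin.castLE h) (Fin.castLE h)) k ≠ 0 := by
    intro k hk
    rw [pivotNorm_sub h A k hk]; exact hpA k (by omega)
  refine ⟨?_, fun k hk => hp k (by omega), ?_⟩
  · rw [det_eq _ (fun k hk => hp k (by omega)), Finset.prod_ne_zero_iff]
    intro i _ h0
    apply hp i.1 i.2
    rw [pivotNorm_eq, h0, norm_zero]
  · intro k i j hi hj hij
    rw [geIter_sub, pivotNorm_sub h A k (by omega)]
    exact hA.2.2 k _ _ hi hj hij

lemma eps_le (hϵ : 0 < ϵ) {n : ℕ} {A : Matrix (Fin n) (Fin n) 𝕜} (hA : IsCPeps (fun _ => ϵ) A)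
    (k : ℕ) (i j : Fin n) (hi : k ≤ i.1) (hj : k ≤ j.1) :
    ‖geIter A k i j‖ ≤ (1 + ϵ) * pivotNorm A k := by
  by_cases h : i.1 = k ∧ j.1 = k
  · have h1 : i = j := Fin.ext (h.1.trans h.2.symm)
    subst h1
    rw [← h.1, pivotNorm_eq]
    nlinarith [norm_nonneg (geIter A i.1 i i)]
  · exact hA.2.2 k i j hi hj h

lemma iter_bound (hϵ : 0 < ϵ) {n : ℕ} {A : Matrix (Fin n) (Fin n) 𝕜}
    (hA : IsCPeps (fun _ => ϵ) A) (k : ℕ) : ∀ (i j : Fin n), k ≤ i.1 → k ≤ j.1 →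
    ‖geIter A k i j‖ ≤ (1 + (1 + ϵ) ^ 2) ^ k * mxN A := by
  induction k with
  | zero => intro i j _ _; simpa [geIter] using le_mxN A i j
  | succ k ih =>
    intro i j hi hj
    have hk : k < n := by omega
    have hp := pivot_ne hA.1 hA.2.1 k hk
    have hP : 0 < pivotNorm A k := lt_of_le_of_ne (pivotNorm_nonneg A k) hp.symm
    have hPe := pivotNorm_eq A ⟨k, hk⟩
    simp only at hPe
    rw [geIter_succ A ⟨k, hk⟩ i j hi hj]
    have h1 := ih i j (by omega) (by omega)
    have h2 := eps_le hϵ hA k i ⟨k, hk⟩ (by omega) le_rfl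
    have h3 := eps_le hϵ hA k ⟨k, hk⟩ j le_rfl (by omega)
    have h4 := ih ⟨k, hk⟩ ⟨k, hk⟩ le_rfl le_rfl
    rw [← hPe] at h4
    have h5 : ‖geIter A k i ⟨k, hk⟩ * geIter A k ⟨k, hk⟩ j / geIter A k ⟨k, hk⟩ ⟨k, hk⟩‖ ≤
        (1 + ϵ) ^ 2 * pivotNorm A k := by
      rw [norm_div, norm_mul, ← hPe, div_le_iff₀ hP]
      calc _ ≤ ((1 + ϵ) * pivotNorm A k) * ((1 + ϵ) * pivotNorm A k) :=
            mul_le_mul h2 h3 (norm_nonneg _) (by positivity)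
        _ = _ := by ring
    have h6 : (1 + ϵ) ^ 2 * pivotNorm A k ≤ (1 + ϵ) ^ 2 * ((1 + (1 + ϵ) ^ 2) ^ k * mxN A) :=
      mul_le_mul_of_nonneg_left h4 (by positivity)
    calc _ ≤ _ := norm_sub_le _ _
      _ ≤ (1 + (1 + ϵ) ^ 2) ^ k * mxN A + (1 + ϵ) ^ 2 * ((1 + (1 + ϵ) ^ 2) ^ k * mxN A) := by
          linarith
      _ = _ := by ring

lemma bdd_eps (𝕜 : Type*) [RCLike 𝕜] (hϵ : 0 < ϵ) (n : ℕ) :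
    BddAbove (growth '' {A : Matrix (Fin n) (Fin n) 𝕜 | IsCPeps (fun _ => ϵ) A}) := by
  refine ⟨(1 + (1 + ϵ) ^ 2) ^ n, ?_⟩
  rintro _ ⟨A, hA, rfl⟩
  rw [growth_eq]
  refine div_le_of_le_mul₀ (mxN_nonneg A) (by positivity) ?_
  refine numN_le A (mul_nonneg (by positivity) (mxN_nonneg A)) ?_
  intro k i j hi hj
  refine (iter_bound hϵ hA k i j hi hj).trans ?_
  refine mul_le_mul_of_nonneg_right ?_ (mxN_nonneg A)
  exact pow_le_pow_right₀ (by nlinarith) (by omega)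

lemma bdd_cp (𝕜 : Type*) [RCLike 𝕜] (n : ℕ) :
    BddAbove (growth '' {A : Matrix (Fin n) (Fin n) 𝕜 | IsCP A}) := by
  refine (bdd_eps 𝕜 (ϵ := 1) one_pos n).mono (Set.image_mono ?_)
  intro A hA
  refine ⟨hA.1, hA.2.1, fun k i j hi hj _ => (hA.2.2 k i j hi hj).trans ?_⟩
  nlinarith [pivotNorm_nonneg A k]

lemma gCPeps_nonneg (𝕜 : Type*) [RCLike 𝕜] (n : ℕ) (ϵ : ℝ) : 0 ≤ gCPeps 𝕜 n ϵ := by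
  apply Real.sSup_nonneg
  rintro _ ⟨A, _, rfl⟩
  exact growth_nonneg A

lemma gCP_nonneg (𝕜 : Type*) [RCLike 𝕜] (n : ℕ) : 0 ≤ gCP 𝕜 n := by
  apply Real.sSup_nonneg
  rintro _ ⟨A, _, rfl⟩
  exact growth_nonneg A

lemma pivot_le (hϵ : 0 < ϵ) {m n : ℕ} (h : m ≤ n) {A : Matrix (Fin n) (Fin n) 𝕜}
    (hA : IsCPeps (fun _ => ϵ) A) (j : ℕ) (hj : j < m) :
    pivotNorm A j ≤ gCPeps 𝕜 m ϵ * mxN A := by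
  set B := A.submatrix (Fin.castLE h) (Fin.castLE h) with hB
  have hBm : IsCPeps (fun _ => ϵ) B := sub_mem_eps h hA
  have hg : growth B ≤ gCPeps 𝕜 m ϵ := le_csSup (bdd_eps 𝕜 hϵ m) ⟨B, hBm, rfl⟩
  have h1 : pivotNorm A j ≤ numN B := by
    rw [← pivotNorm_sub h A j hj, pivotNorm_eq B ⟨j, hj⟩]
    exact le_numN B j _ _ le_rfl le_rfl
  have h2 : mxN B ≤ mxN A := mxN_le B (mxN_nonneg A) fun i k => le_mxN A _ _
  have h3 : 0 < mxN B := by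
    have h0 : 0 < m := by omega
    have h4 := pivot_ne hBm.1 hBm.2.1 0 h0
    have h5 := le_mxN B ⟨0, h0⟩ ⟨0, h0⟩
    have h6 := pivotNorm_eq B ⟨0, h0⟩
    simp only [geIter] at h6
    rw [← h6] at h5
    exact lt_of_lt_of_le (lt_of_le_of_ne (pivotNorm_nonneg B 0) h4.symm) h5
  have h7 : numN B = growth B * mxN B := by rw [growth_eq]; field_simp
  rw [h7] at h1
  exact h1.trans (mul_le_mul hg h2 h3.le (gCPeps_nonneg _ _ _))

/-- Perturbing an almost completely pivoted matrix to a completely pivoted one. -/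
lemma perturb (hϵ : 0 < ϵ) {N : ℕ} {A : Matrix (Fin (N + 1)) (Fin (N + 1)) 𝕜}
    (hA : IsCPeps (fun _ => ϵ) A) (e : ℕ → ℝ) (heN : e N = 0) (he : Antitone e)
    (he1 : ∀ k < N, ϵ * (2 + ϵ) * pivotNorm A k ≤ e k)
    (he2 : ∀ k < N, ϵ * pivotNorm A k + e (k + 1) ≤ e k) :
    ∃ B : Matrix (Fin (N + 1)) (Fin (N + 1)) 𝕜, IsCP B ∧
      ∀ k, k ≤ N → pivotNorm B k = pivotNorm A k + e k := by
  have hP : ∀ k : Fin (N + 1), 0 < pivotNorm A k.1 := fun k =>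
    lt_of_le_of_ne (pivotNorm_nonneg A k) (pivot_ne hA.1 hA.2.1 k k.2).symm
  have he0 : ∀ k : Fin (N + 1), 0 ≤ e k.1 := fun k => heN ▸ he (Nat.lt_succ_iff.mp k.2)
  let γ : ℕ → ℝ := fun k => 1 + e k / pivotNorm A k
  have hγ1 : ∀ k : Fin (N + 1), 1 ≤ γ k.1 := fun k => by
    have := div_nonneg (he0 k) (hP k).le
    simp only [γ]; linarith
  have hγP : ∀ k : Fin (N + 1), γ k.1 * pivotNorm A k.1 = pivotNorm A k.1 + e k.1 := fun k => by
    have := (hP k).ne'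
    simp only [γ]; field_simp
  let E : Matrix (Fin (N + 1)) (Fin (N + 1)) 𝕜 := fun i j =>
    if i = j then ((γ i.1 - 1 : ℝ) : 𝕜) * geIter A i.1 i i
    else if j < i then ((γ j.1 / (1 + ϵ) - 1 : ℝ) : 𝕜) * geIter A j.1 i j
    else (ϵ : 𝕜) * geIter A i.1 i j
  have hEd : ∀ k, geIter A k.1 k k + E k k = (γ k.1 : 𝕜) * geIter A k.1 k k := by
    intro k; simp [E]; ring
  have hEl : ∀ i k : Fin (N + 1), k < i →
      geIter A k.1 i k + E i k = ((γ k.1 / (1 + ϵ) : ℝ) : 𝕜) * geIter A k.1 i k := by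
    intro i k h; simp [E, h, h.ne']; ring
  have hEu : ∀ k j : Fin (N + 1), k < j →
      geIter A k.1 k j + E k j = ((1 + ϵ : ℝ) : 𝕜) * geIter A k.1 k j := by
    intro k j h; simp [E, h.ne, h.not_gt]; ring
  have hpiv : ∀ k : Fin (N + 1), geIter A k.1 k k ≠ 0 := by
    intro k h0
    have := hP k
    rw [pivotNorm_eq, h0, norm_zero] at this
    exact lt_irrefl _ this
  have key : ∀ (k : ℕ) (i j : Fin (N + 1)), k ≤ i.1 → k ≤ j.1 →
      geIter (A + E) k i j = geIter A k i j + E i j := by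
    intro k
    induction k with
    | zero => intro i j _ _; rfl
    | succ k ih =>
      intro i j hi hj
      have hk : k < N + 1 := by omega
      obtain ⟨κ, hκ⟩ : ∃ κ : Fin (N + 1), κ.1 = k := ⟨⟨k, hk⟩, rfl⟩
      subst hκ
      have hi' : κ < i := hi
      have hj' : κ < j := hj
      rw [geIter_succ _ κ i j hi' hj', geIter_succ _ κ i j hi' hj',
        ih i j hi'.le hj'.le, ih i κ hi'.le le_rfl, ih κ j le_rfl hj'.le, ih κ κ le_rfl le_rfl,
        hEd, hEl i κ hi', hEu κ j hj']
      have g1 : (γ κ.1 : 𝕜) ≠ 0 := by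
        have := hγ1 κ
        exact_mod_cast (by linarith : γ κ.1 ≠ 0)
      have g2 : ((1 + ϵ : ℝ) : 𝕜) ≠ 0 := by
        exact_mod_cast (by linarith : (1 + ϵ : ℝ) ≠ 0)
      have g3 := hpiv κ
      have g4 : ((γ κ.1 / (1 + ϵ) : ℝ) : 𝕜) = (γ κ.1 : 𝕜) / ((1 + ϵ : ℝ) : 𝕜) := by
        rw [RCLike.ofReal_div]
      rw [g4]
      generalize ((1 + ϵ : ℝ) : 𝕜) = u at *
      field_simp
      ring
  have hpB : ∀ k : Fin (N + 1), pivotNorm (A + E) k.1 = pivotNorm A k.1 + e k.1 := by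
    intro k
    rw [pivotNorm_eq, key k.1 k k le_rfl le_rfl, hEd, norm_mul, ← pivotNorm_eq, ← hγP,
      RCLike.norm_ofReal, abs_of_nonneg (by linarith [hγ1 k])]
  have hγ2 : ∀ k : Fin (N + 1), k.1 < N → (1 + ϵ) ^ 2 * pivotNorm A k.1 ≤ γ k.1 * pivotNorm A k.1 := by
    intro k hk
    rw [hγP]; nlinarith [he1 k.1 hk]
  have hγ3 : ∀ k : Fin (N + 1), k.1 < N → 1 + ϵ ≤ γ k.1 := by
    intro k hk
    have := le_of_mul_le_mul_right (hγ2 k hk) (hP k)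
    nlinarith
  have hEb : ∀ i j : Fin (N + 1), ‖E i j‖ ≤ e (min i.1 j.1) := by
    intro i j
    rcases lt_trichotomy i j with h | h | h
    · have hN : i.1 < N := by have := j.2; have : i.1 < j.1 := h; omega
      have h1 : min i.1 j.1 = i.1 := min_eq_left h.le
      have h2 := eps_le hϵ hA i.1 i j le_rfl h.le
      have h3 := he1 i.1 hN
      have : E i j = (ϵ : 𝕜) * geIter A i.1 i j := by simp [E, h.ne, h.not_gt]
      rw [h1, this, norm_mul, RCLike.norm_ofReal, abs_of_pos hϵ]
      nlinarith [mul_le_mul_of_nonneg_left h2 hϵ.le, mul_pos hϵ (hP i)]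
    · subst h
      have : E i i = ((γ i.1 - 1 : ℝ) : 𝕜) * geIter A i.1 i i := by simp [E]
      rw [min_self, this, norm_mul, RCLike.norm_ofReal, abs_of_nonneg (by linarith [hγ1 i]),
        ← pivotNorm_eq]
      linarith [hγP i]
    · have hN : j.1 < N := by have := i.2; have : j.1 < i.1 := h; omega
      have h1 : min i.1 j.1 = j.1 := min_eq_right h.le
      have h2 := eps_le hϵ hA j.1 i j h.le le_rfl
      have : E i j = ((γ j.1 / (1 + ϵ) - 1 : ℝ) : 𝕜) * geIter A j.1 i j := by
        simp [E, h.ne', h]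
      have h4 : 0 ≤ γ j.1 / (1 + ϵ) - 1 := by
        rw [sub_nonneg, le_div_iff₀ (by linarith)]; linarith [hγ3 j hN]
      rw [h1, this, norm_mul, RCLike.norm_ofReal, abs_of_nonneg h4]
      refine (mul_le_mul_of_nonneg_left h2 h4).trans ?_
      have h5 : (γ j.1 / (1 + ϵ) - 1) * ((1 + ϵ) * pivotNorm A j.1)
          = γ j.1 * pivotNorm A j.1 - (1 + ϵ) * pivotNorm A j.1 := by
        have : (1 + ϵ) ≠ 0 := by linarith
        field_simp
      rw [h5, hγP]
      nlinarith [mul_pos hϵ (hP j)]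
  have hpBne : ∀ k, k < N + 1 → pivotNorm (A + E) k ≠ 0 := by
    intro k hk
    have h1 := hpB ⟨k, hk⟩
    have h2 := hP ⟨k, hk⟩
    have h3 := he0 ⟨k, hk⟩
    simp only at h1 h2 h3
    rw [h1]; linarith
  refine ⟨A + E, ⟨?_, fun k hk => hpBne k (by omega), ?_⟩, fun k hk => hpB ⟨k, by omega⟩⟩
  · rw [det_eq _ (fun k hk => hpBne k (by omega)), Finset.prod_ne_zero_iff]
    intro i _ h0
    apply hpBne i.1 i.2
    rw [pivotNorm_eq, h0, norm_zero]
  · intro k i j hi hj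
    have hk : k < N + 1 := by omega
    obtain ⟨κ, hκ⟩ : ∃ κ : Fin (N + 1), κ.1 = k := ⟨⟨k, hk⟩, rfl⟩
    subst hκ
    rw [hpB, key _ i j hi hj]
    have hi' : κ ≤ i := hi
    have hj' : κ ≤ j := hj
    rcases hi'.eq_or_lt with h1 | h1
    · subst h1
      rcases hj'.eq_or_lt with h2 | h2
      · subst h2
        rw [← hpB, pivotNorm_eq, key _ _ _ le_rfl le_rfl]
      · have hN : κ.1 < N := by have := j.2; have : κ.1 < j.1 := h2; omega
        rw [hEu κ j h2, norm_mul, RCLike.norm_ofReal, abs_of_nonneg (by linarith), ← hγP]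
        refine le_trans ?_ (hγ2 κ hN)
        have := mul_le_mul_of_nonneg_left (eps_le hϵ hA κ.1 κ j le_rfl hj)
          (by linarith : 0 ≤ 1 + ϵ)
        linarith
    · have hN : κ.1 < N := by have := i.2; have : κ.1 < i.1 := h1; omega
      rcases hj'.eq_or_lt with h2 | h2
      · subst h2
        have h4 : 0 ≤ γ κ.1 / (1 + ϵ) := div_nonneg (by linarith [hγ1 κ]) (by linarith)
        rw [hEl i κ h1, norm_mul, RCLike.norm_ofReal, abs_of_nonneg h4, ← hγP]
        refine (mul_le_mul_of_nonneg_left (eps_le hϵ hA κ.1 i κ hi le_rfl) h4).trans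
          (le_of_eq ?_)
        have : (1 + ϵ) ≠ 0 := by linarith
        field_simp
      · refine (norm_add_le _ _).trans ?_
        have h3 := eps_le hϵ hA κ.1 i j hi hj
        have h4 : e (min i.1 j.1) ≤ e (κ.1 + 1) := he (le_min h1 h2)
        have h5 := hEb i j
        have h6 := he2 κ.1 hN
        linarith

lemma exists_cp (hϵ : 0 < ϵ) {N : ℕ} {A : Matrix (Fin (N + 1)) (Fin (N + 1)) 𝕜}
    (hA : IsCPeps (fun _ => ϵ) A) :
    growth A ≤ (1 + ϵ * (2 + ϵ) * gCPeps 𝕜 N ϵ +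
          ϵ * ∑ i ∈ Finset.Icc 1 (N - 1), gCPeps 𝕜 i ϵ) * gCP 𝕜 (N + 1) := by
  set G := gCPeps 𝕜 N ϵ with hG
  set M := mxN A with hM
  have hG0 : 0 ≤ G := gCPeps_nonneg _ _ _
  have hM0 : 0 ≤ M := mxN_nonneg A
  have hPle : ∀ k < N, pivotNorm A k ≤ G * M := fun k hk =>
    pivot_le hϵ (Nat.le_succ N) hA k hk
  have hS0 : ∀ k, 0 ≤ ∑ i ∈ Finset.Ico k (N - 1), pivotNorm A i := fun k =>
    Finset.sum_nonneg fun i _ => pivotNorm_nonneg A i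
  have hc0 : 0 ≤ ϵ * (2 + ϵ) * (G * M) := by positivity
  let e : ℕ → ℝ := fun k => if k < N then
    ϵ * (2 + ϵ) * (G * M) + ϵ * ∑ i ∈ Finset.Ico k (N - 1), pivotNorm A i else 0
  have hanti : Antitone e := by
    apply antitone_nat_of_succ_le
    intro k
    simp only [e]
    by_cases h1 : k + 1 < N
    · rw [if_pos h1, if_pos (by omega)]
      have : ∑ i ∈ Finset.Ico (k + 1) (N - 1), pivotNorm A i ≤
          ∑ i ∈ Finset.Ico k (N - 1), pivotNorm A i :=
        Finset.sum_le_sum_of_subset_of_nonneg (Finset.Ico_subset_Ico (by omega) le_rfl)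
          fun i _ _ => pivotNorm_nonneg A i
      nlinarith
    · rw [if_neg h1]
      split_ifs
      · have := hS0 k
        positivity
      · exact le_rfl
  obtain ⟨B, hB, hBp⟩ := perturb hϵ hA e (by simp [e]) hanti
    (by
      intro k hk
      simp only [e, if_pos hk]
      have h1 := mul_le_mul_of_nonneg_left (hPle k hk) (by positivity : 0 ≤ ϵ * (2 + ϵ))
      have h2 := mul_nonneg hϵ.le (hS0 k)
      linarith)
    (by
      intro k hk
      simp only [e, if_pos hk]
      by_cases h1 : k + 1 < N
      · rw [if_pos h1, Finset.sum_eq_sum_Ico_succ_bot (by omega : k < N - 1)]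
        linarith
      · rw [if_neg h1]
        have h2 := mul_nonneg hϵ.le (hS0 k)
        have h3 := hPle k hk
        have h4 := pivotNorm_nonneg A k
        nlinarith [mul_le_mul_of_nonneg_left h3 hϵ.le, mul_nonneg hϵ.le (h4.trans h3),
          mul_nonneg (mul_nonneg hϵ.le hϵ.le) (h4.trans h3)])
  have hgB : growth B ≤ gCP 𝕜 (N + 1) := le_csSup (bdd_cp 𝕜 (N + 1)) ⟨B, hB, rfl⟩
  have hP0 : 0 < pivotNorm A 0 :=
    lt_of_le_of_ne (pivotNorm_nonneg A 0) (pivot_ne hA.1 hA.2.1 0 (by omega)).symm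
  have hP0M : pivotNorm A 0 ≤ M := by
    have h6 := pivotNorm_eq A 0
    simp only [Fin.val_zero, geIter] at h6
    rw [h6]; exact le_mxN A 0 0
  have hMpos : 0 < M := lt_of_lt_of_le hP0 hP0M
  have he00 : 0 ≤ e 0 := by
    have : e N = 0 := by simp [e]
    rw [← this]; exact hanti (Nat.zero_le N)
  set D := 1 + ϵ * (2 + ϵ) * G + ϵ * ∑ i ∈ Finset.Icc 1 (N - 1), gCPeps 𝕜 i ϵ with hD
  have hsg : 0 ≤ ∑ i ∈ Finset.Icc 1 (N - 1), gCPeps 𝕜 i ϵ :=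
    Finset.sum_nonneg fun i _ => gCPeps_nonneg _ _ _
  have hD0 : 0 < D := by positivity
  have heD : pivotNorm A 0 + e 0 ≤ M * D := by
    have hs : ∑ i ∈ Finset.Ico 0 (N - 1), pivotNorm A i ≤
        M * ∑ i ∈ Finset.Icc 1 (N - 1), gCPeps 𝕜 i ϵ := by
      rw [Finset.mul_sum, ← Finset.Ico_succ_right_eq_Icc, Finset.sum_Ico_eq_sum_range,
        Finset.sum_Ico_eq_sum_range]
      simp only [Nat.sub_zero, Order.succ_eq_add_one, Nat.add_sub_cancel]
      refine Finset.sum_le_sum fun i hi => ?_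
      rw [Finset.mem_range] at hi
      rw [mul_comm, zero_add, add_comm 1 i]
      exact pivot_le hϵ (by omega) hA i (by omega)
    have h1 : e 0 ≤ ϵ * (2 + ϵ) * (G * M) + ϵ * ∑ i ∈ Finset.Ico 0 (N - 1), pivotNorm A i := by
      simp only [e]
      split_ifs
      · exact le_rfl
      · have := hS0 0
        positivity
    have h2 := mul_le_mul_of_nonneg_left hs hϵ.le
    rw [hD]
    nlinarith
  have hmB : mxN B ≤ M * D := by
    refine le_trans (mxN_le B (by linarith) fun i j => ?_) heD
    have := hB.2.2 0 i j (Nat.zero_le _) (Nat.zero_le _)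
    rw [hBp 0 (Nat.zero_le _)] at this
    exact this
  have hmB0 : 0 < mxN B := by
    have h6 := pivotNorm_eq B 0
    simp only [Fin.val_zero, geIter] at h6
    have h7 := le_mxN B 0 0
    rw [← h6, hBp 0 (Nat.zero_le _)] at h7
    linarith
  have hnum : numN A ≤ numN B := by
    refine numN_le A (numN_nonneg B) fun k i j hi hj => ?_
    have hk : k ≤ N := by omega
    have hb : pivotNorm B k ≤ numN B := by
      rw [pivotNorm_eq B ⟨k, by omega⟩]
      exact le_numN B k _ _ le_rfl le_rfl
    refine le_trans ?_ hb
    rw [hBp k hk]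
    rcases hk.lt_or_eq with h | h
    · have h1 := eps_le hϵ hA k i j hi hj
      have h2 : ϵ * pivotNorm A k ≤ e k := by
        simp only [e, if_pos h]
        have h3 := hPle k h
        have h4 := pivotNorm_nonneg A k
        have h2 := mul_nonneg hϵ.le (hS0 k)
        nlinarith [mul_le_mul_of_nonneg_left h3 hϵ.le, mul_nonneg hϵ.le (h4.trans h3),
          mul_nonneg (mul_nonneg hϵ.le hϵ.le) (h4.trans h3)]
      linarith
    · have h1 : i = j := Fin.ext (by omega)
      have h2 : k = j.1 := by omega
      subst h1
      rw [h2, pivotNorm_eq]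
      have : 0 ≤ e i.1 := by
        have h0 : e N = 0 := by simp [e]
        rw [← h0]; exact hanti (by omega)
      linarith
  calc growth A = numN A / M := growth_eq A
    _ ≤ numN B / M := by gcongr
    _ ≤ D * (numN B / mxN B) := by
        rw [div_le_iff₀ hMpos]
        have : numN B ≤ numN B / mxN B * (M * D) := by
          calc numN B = numN B / mxN B * mxN B := by field_simp
            _ ≤ _ := mul_le_mul_of_nonneg_left hmB (div_nonneg (numN_nonneg B) hmB0.le)
        linarith
    _ ≤ D * gCP 𝕜 (N + 1) := by
        rw [← growth_eq]; exact mul_le_mul_of_nonneg_left hgB hD0.le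

end helpers

/-- threshold pivoting versus complete pivoting. -/
theorem cp_threshold_bound {𝕜 : Type*} [RCLike 𝕜] (n : ℕ) (ϵ : ℝ) (hϵ : 0 < ϵ) :
    gCPeps 𝕜 n ϵ /
        (1 + ϵ * (2 + ϵ) * gCPeps 𝕜 (n - 1) ϵ +
          ϵ * ∑ i ∈ Finset.Icc 1 (n - 2), gCPeps 𝕜 i ϵ) ≤
      gCP 𝕜 n := by
  have hD : 0 < 1 + ϵ * (2 + ϵ) * gCPeps 𝕜 (n - 1) ϵ +
          ϵ * ∑ i ∈ Finset.Icc 1 (n - 2), gCPeps 𝕜 i ϵ := by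
    have h1 := gCPeps_nonneg 𝕜 (n - 1) ϵ
    have h2 : 0 ≤ ∑ i ∈ Finset.Icc 1 (n - 2), gCPeps 𝕜 i ϵ :=
      Finset.sum_nonneg fun i _ => gCPeps_nonneg _ _ _
    positivity
  rw [div_le_iff₀ hD, mul_comm]
  refine Real.sSup_le ?_ (mul_nonneg hD.le (gCP_nonneg 𝕜 n))
  rintro _ ⟨A, hA, rfl⟩
  cases n with
  | zero =>
    have : growth A = 0 := by simp [growth]
    rw [this]
    exact mul_nonneg hD.le (gCP_nonneg 𝕜 0)
  | succ N => exact exists_cp hϵ hA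
end

section
/- Let 𝕜 be ℝ or ℂ, let A ∈ CP_n(𝕜), and let ε > 0 satisfy |a^{(k)}_{i,j}| ≤ |a^{(k)}_{k,k}| − 2·4^{k−1}·ε for all i,j ≥ k with (i,j) ≠ (k,k) and all k = 1,…,n−1, and additionally 4^{n−1}·ε < |a^{(n)}_{n,n}|. Then every n×n matrix B with entries in 𝕜 satisfying |a_{i,j} − b_{i,j}| ≤ ε for all i,j lies in CP_n(𝕜), and moreover every such B satisfies g(B) ≥ g(A) − ε·(4^{n−1} + g(A)) / |a_{1,1}|. -/
open scoped BigOperators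

theorem aux_step {𝕜 : Type*} [RCLike 𝕜] (a b x y p a' b' x' y' p' : 𝕜) (δ : ℝ) (hδ : 0 < δ)
    (hab : a = b) (hab' : a' = b')
    (ha : ‖b - b'‖ ≤ δ) (hx : ‖x - x'‖ ≤ δ) (hy : ‖y - y'‖ ≤ δ) (hp : ‖p - p'‖ ≤ δ)
    (hxp : ‖x‖ ≤ ‖p‖ - 2 * δ) (hyp : ‖y‖ ≤ ‖p‖ - 2 * δ) :
    ‖(a - x * y / p) - (a' - x' * y' / p')‖ ≤ 4 * δ := by
  subst hab hab'
  have hx0 := norm_nonneg x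
  have hP : 0 < ‖p‖ := by linarith
  have h1 : ‖p‖ - ‖p'‖ ≤ δ := (norm_sub_norm_le p p').trans hp
  have hP' : 0 < ‖p'‖ := by linarith
  have h2 : ‖x'‖ - ‖x‖ ≤ δ := by
    have := norm_sub_norm_le x' x
    rw [norm_sub_rev] at this; linarith
  have h3 : ‖y'‖ - ‖y‖ ≤ δ := by
    have := norm_sub_norm_le y' y
    rw [norm_sub_rev] at this; linarith
  have hp0 : p ≠ 0 := norm_pos_iff.mp hP
  have hp0' : p' ≠ 0 := norm_pos_iff.mp hP'
  have key : (a - x * y / p) - (a' - x' * y' / p') =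
      (a - a') - (x - x') * (y / p) - (x' / p) * (y - y') + (x' / p) * (y' / p') * (p - p') := by
    field_simp
    ring
  have q1 : ‖y / p‖ ≤ 1 := by
    rw [norm_div, div_le_one hP]; linarith
  have q2 : ‖x' / p‖ ≤ 1 := by
    rw [norm_div, div_le_one hP]; linarith
  have q3 : ‖y' / p'‖ ≤ 1 := by
    rw [norm_div, div_le_one hP']; linarith
  have t1 : ‖(x - x') * (y / p)‖ ≤ δ := by
    rw [norm_mul]
    calc _ ≤ δ * 1 := by gcongr
      _ = δ := mul_one _
  have t2 : ‖(x' / p) * (y - y')‖ ≤ δ := by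
    rw [norm_mul]
    calc _ ≤ 1 * δ := by gcongr
      _ = δ := one_mul _
  have t3 : ‖(x' / p) * (y' / p') * (p - p')‖ ≤ δ := by
    rw [norm_mul, norm_mul]
    calc _ ≤ 1 * 1 * δ := by gcongr
      _ = δ := by ring
  rw [key]
  have n1 := norm_add_le ((a - a') - (x - x') * (y / p) - (x' / p) * (y - y'))
    ((x' / p) * (y' / p') * (p - p'))
  have n2 := norm_sub_le ((a - a') - (x - x') * (y / p)) ((x' / p) * (y - y'))
  have n3 := norm_sub_le (a - a') ((x - x') * (y / p))
  linarith

theorem aux_pert {𝕜 : Type*} [RCLike 𝕜] {n : ℕ}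
    (A B : Matrix (Fin n) (Fin n) 𝕜) (ε : ℝ) (hε : 0 < ε)
    (hgap : ∀ (k : ℕ) (i j : Fin n), k + 1 < n → k ≤ i.1 → k ≤ j.1 →
      ¬(i.1 = k ∧ j.1 = k) →
      ‖geIter A k i j‖ ≤ pivotNorm A k - 2 * 4 ^ k * ε)
    (hB : ∀ i j, ‖A i j - B i j‖ ≤ ε) (k : ℕ) :
    ∀ i j : Fin n, k ≤ i.1 → k ≤ j.1 → ‖geIter A k i j - geIter B k i j‖ ≤ 4 ^ k * ε := by
  induction k with
  | zero => intro i j _ _; simpa [geIter] using hB i j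
  | succ k ih =>
    intro i j hi hj
    have hk : k + 1 < n := by omega
    have hk' : k < n := by omega
    have h : k < n ∧ k + 1 ≤ i.1 ∧ k + 1 ≤ j.1 := ⟨hk', hi, hj⟩
    have hpv : pivotNorm A k = ‖geIter A k ⟨k, hk'⟩ ⟨k, hk'⟩‖ := by simp [pivotNorm, hk']
    have g1 := hgap k i ⟨k, hk'⟩ hk (by omega) le_rfl (by rintro ⟨h1, -⟩; omega)
    have g2 := hgap k ⟨k, hk'⟩ j hk le_rfl (by omega) (by rintro ⟨-, h1⟩; omega)
    rw [hpv] at g1 g2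
    simp only [geIter, dif_pos h]
    rw [pow_succ, show (4:ℝ) ^ k * 4 * ε = 4 * (4 ^ k * ε) by ring]
    refine aux_step _ _ _ _ _ _ _ _ _ _ _ (by positivity) rfl rfl (ih i j (by omega) (by omega))
      (ih i _ (by omega) le_rfl) (ih _ j le_rfl (by omega)) (ih _ _ le_rfl le_rfl)
      (by linarith) (by linarith)

theorem aux_ker {𝕜 : Type*} [RCLike 𝕜] {n : ℕ} (B : Matrix (Fin n) (Fin n) 𝕜)
    (hp : ∀ k, k < n → pivotNorm B k ≠ 0) (v : Fin n → 𝕜) (hv : B.mulVec v = 0) (k : ℕ) :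
    ∀ i : Fin n, k ≤ i.1 → ∑ j : Fin n, (if k ≤ j.1 then geIter B k i j * v j else 0) = 0 := by
  induction k with
  | zero =>
    intro i _
    have := congrFun hv i
    simpa [geIter, Matrix.mulVec, dotProduct] using this
  | succ k ih =>
    intro i hi
    have hk : k < n := by omega
    have hne : geIter B k ⟨k, hk⟩ ⟨k, hk⟩ ≠ 0 := by
      have := hp k hk
      simpa [pivotNorm, hk] using this
    have e1 := ih i (by omega)
    have e2 := ih ⟨k, hk⟩ le_rfl
    have : ∀ j : Fin n, (if k + 1 ≤ j.1 then geIter B (k+1) i j * v j else 0) =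
        (if k ≤ j.1 then geIter B k i j * v j else 0) -
        (geIter B k i ⟨k, hk⟩ / geIter B k ⟨k, hk⟩ ⟨k, hk⟩) *
        (if k ≤ j.1 then geIter B k ⟨k, hk⟩ j * v j else 0) := by
      intro j
      rcases lt_trichotomy k j.1 with h | h | h
      · have h' : k < n ∧ k + 1 ≤ i.1 ∧ k + 1 ≤ j.1 := ⟨hk, hi, h⟩
        rw [if_pos (by omega), if_pos (by omega), if_pos (by omega)]
        simp only [geIter, dif_pos h']
        field_simp
      · have hj : j = ⟨k, hk⟩ := Fin.ext h.symm
        subst hj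
        simp only [le_refl, if_true]
        rw [if_neg (by omega)]
        field_simp
        simp
      · rw [if_neg (by omega), if_neg (by omega), if_neg (by omega)]
        simp
    rw [Finset.sum_congr rfl (fun j _ => this j), Finset.sum_sub_distrib, ← Finset.mul_sum, e1, e2]
    simp

theorem aux_det {𝕜 : Type*} [RCLike 𝕜] {n : ℕ} (B : Matrix (Fin n) (Fin n) 𝕜)
    (hp : ∀ k, k < n → pivotNorm B k ≠ 0) : B.det ≠ 0 := by
  intro hd
  obtain ⟨v, hv0, hv⟩ := Matrix.exists_mulVec_eq_zero_iff.mpr hd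
  apply hv0
  have main : ∀ m : ℕ, ∀ j : Fin n, n ≤ j.1 + m → v j = 0 := by
    intro m
    induction m with
    | zero => intro j hj; omega
    | succ m ihm =>
      intro j hj
      have hs := aux_ker B hp v hv j.1 j le_rfl
      rw [Finset.sum_eq_single j] at hs
      · have hne := hp j.1 j.2
        simp only [le_refl, if_true, mul_eq_zero] at hs
        rcases hs with h | h
        · simp [pivotNorm, h] at hne
        · exact h
      · intro l _ hl
        split_ifs with hjl
        · rw [ihm l, mul_zero]
          have : j.1 ≠ l.1 := fun h => hl (Fin.ext h.symm)
          omega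
        · rfl
      · simp
  ext j
  exact main n j (by omega)

theorem aux_le_iSup2 {n : ℕ} (f : Fin n → Fin n → ℝ) (i j : Fin n) :
    f i j ≤ ⨆ i, ⨆ j, f i j :=
  (le_ciSup (f := f i) (Set.finite_range _).bddAbove j).trans
    (le_ciSup (f := fun i => ⨆ j, f i j) (Set.finite_range _).bddAbove i)

theorem aux_le_iSup3 {n : ℕ} (f : Fin n → Fin n → Fin n → ℝ) (k i j : Fin n) :
    f k i j ≤ ⨆ k, ⨆ i, ⨆ j, f k i j :=
  (aux_le_iSup2 (f k) i j).trans
    (le_ciSup (f := fun k => ⨆ i, ⨆ j, f k i j) (Set.finite_range _).bddAbove k)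

/-- matrices strictly inside `CP_n(𝕜)` are stable under entrywise
perturbations of size `ε`, with controlled loss in the growth factor.
(0-indexed: the paper's `2·4^{k-1}` is `2·4^k` here.) -/
theorem cp_eps_ball {𝕜 : Type*} [RCLike 𝕜] {n : ℕ} (hn : 1 ≤ n)
    (A : Matrix (Fin n) (Fin n) 𝕜) (hA : IsCP A) (ε : ℝ) (hε : 0 < ε)
    (hgap : ∀ (k : ℕ) (i j : Fin n), k + 1 < n → k ≤ i.1 → k ≤ j.1 →
      ¬(i.1 = k ∧ j.1 = k) →
      ‖geIter A k i j‖ ≤ pivotNorm A k - 2 * 4 ^ k * ε)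
    (hlast : 4 ^ (n - 1) * ε < pivotNorm A (n - 1)) :
    ∀ B : Matrix (Fin n) (Fin n) 𝕜, (∀ i j, ‖A i j - B i j‖ ≤ ε) →
      IsCP B ∧
        growth A - ε * (4 ^ (n - 1) + growth A) / ‖A ⟨0, by omega⟩ ⟨0, by omega⟩‖ ≤
          growth B := by
  intro B hB
  have pert := aux_pert A B ε hε hgap hB
  haveI : Nonempty (Fin n) := ⟨⟨0, by omega⟩⟩
  have hpivA : ∀ k (hk : k < n), pivotNorm A k = ‖geIter A k ⟨k, hk⟩ ⟨k, hk⟩‖ :=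
    fun k hk => by simp [pivotNorm, hk]
  have hpivB : ∀ k (hk : k < n), pivotNorm B k = ‖geIter B k ⟨k, hk⟩ ⟨k, hk⟩‖ :=
    fun k hk => by simp [pivotNorm, hk]
  have hpp : ∀ k, k < n → pivotNorm A k - 4 ^ k * ε ≤ pivotNorm B k := by
    intro k hk
    rw [hpivA k hk, hpivB k hk]
    have := (norm_sub_norm_le _ _).trans (pert k ⟨k, hk⟩ ⟨k, hk⟩ le_rfl le_rfl)
    linarith
  have hApos : ∀ k, k < n → 4 ^ k * ε < pivotNorm A k := by
    intro k hk
    by_cases h : k + 1 < n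
    · have g := hgap k ⟨k, hk⟩ ⟨k + 1, h⟩ h le_rfl (by simp) (by simp)
      have h0 := norm_nonneg (geIter A k ⟨k, hk⟩ ⟨k + 1, h⟩)
      have : (0:ℝ) < 4 ^ k * ε := by positivity
      linarith
    · obtain rfl : k = n - 1 := by omega
      exact hlast
  have hBpos : ∀ k, k < n → 0 < pivotNorm B k := by
    intro k hk
    have := hpp k hk
    have := hApos k hk
    linarith
  refine ⟨⟨aux_det B fun k hk => (hBpos k hk).ne', fun k hk => (hBpos k (by omega)).ne', ?_⟩, ?_⟩
  · intro k i j hi hj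
    have hk : k < n := by omega
    by_cases hij : i.1 = k ∧ j.1 = k
    · obtain rfl : i = ⟨k, hk⟩ := Fin.ext hij.1
      obtain rfl : j = ⟨k, hk⟩ := Fin.ext hij.2
      exact (hpivB k hk).ge
    · have hk1 : k + 1 < n := by omega
      have g := hgap k i j hk1 hi hj hij
      have p1 := pert k i j hi hj
      rw [norm_sub_rev] at p1
      have p2 := (norm_sub_norm_le _ _).trans p1
      have := hpp k hk
      linarith
  · have h0 : 0 < n := by omega
    set α := ‖A ⟨0, by omega⟩ ⟨0, by omega⟩‖ with hα
    have hpA0 : pivotNorm A 0 = α := by rw [hpivA 0 h0]; rfl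
    have hα0 : 0 < α := by
      have := hApos 0 h0
      rw [hpA0] at this
      simp only [pow_zero, one_mul] at this
      linarith
    have hAle : ∀ i j, ‖A i j‖ ≤ α := by
      intro i j
      have := hA.2.2 0 i j (Nat.zero_le _) (Nat.zero_le _)
      rw [hpA0] at this
      exact this
    have hDA : (⨆ i : Fin n, ⨆ j : Fin n, ‖A i j‖) = α :=
      le_antisymm (ciSup_le fun i => ciSup_le fun j => hAle i j)
        (aux_le_iSup2 (fun i j => ‖A i j‖) _ _)
    have hDB : (⨆ i : Fin n, ⨆ j : Fin n, ‖B i j‖) ≤ α + ε := by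
      refine ciSup_le fun i => ciSup_le fun j => ?_
      have p1 := hB i j
      rw [norm_sub_rev] at p1
      have p2 := (norm_sub_norm_le _ _).trans p1
      have := hAle i j
      linarith
    have hDB0 : 0 < ⨆ i : Fin n, ⨆ j : Fin n, ‖B i j‖ := by
      have := hBpos 0 h0
      rw [hpivB 0 h0] at this
      exact this.trans_le (aux_le_iSup2 (fun i j => ‖B i j‖) _ _)
    have hM : (⨆ k : Fin n, ⨆ i : Fin n, ⨆ j : Fin n,
        if k.1 ≤ i.1 ∧ k.1 ≤ j.1 then ‖geIter A k.1 i j‖ else 0) ≤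
        (⨆ k : Fin n, ⨆ i : Fin n, ⨆ j : Fin n,
        if k.1 ≤ i.1 ∧ k.1 ≤ j.1 then ‖geIter B k.1 i j‖ else 0) + 4 ^ (n - 1) * ε := by
      refine ciSup_le fun k => ciSup_le fun i => ciSup_le fun j => ?_
      have hl := aux_le_iSup3 (fun k i j : Fin n =>
        if k.1 ≤ i.1 ∧ k.1 ≤ j.1 then ‖geIter B k.1 i j‖ else 0) k i j
      refine le_trans ?_ (add_le_add_left hl _)
      have hpw : (4:ℝ) ^ k.1 * ε ≤ 4 ^ (n - 1) * ε := by
        gcongr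
        · norm_num
        · omega
      by_cases h : k.1 ≤ i.1 ∧ k.1 ≤ j.1
      · simp only [if_pos h]
        have := (norm_sub_norm_le _ _).trans (pert k.1 i j h.1 h.2)
        linarith
      · simp only [if_neg h]
        positivity
    have hMB0 : 0 ≤ (⨆ k : Fin n, ⨆ i : Fin n, ⨆ j : Fin n,
        if k.1 ≤ i.1 ∧ k.1 ≤ j.1 then ‖geIter B k.1 i j‖ else 0) :=
      Real.iSup_nonneg fun k => Real.iSup_nonneg fun i => Real.iSup_nonneg fun j => by positivity
    have hMA0 : 0 ≤ (⨆ k : Fin n, ⨆ i : Fin n, ⨆ j : Fin n,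
        if k.1 ≤ i.1 ∧ k.1 ≤ j.1 then ‖geIter A k.1 i j‖ else 0) :=
      Real.iSup_nonneg fun k => Real.iSup_nonneg fun i => Real.iSup_nonneg fun j => by positivity
    unfold growth
    rw [hDA]
    generalize (⨆ k : Fin n, ⨆ i : Fin n, ⨆ j : Fin n,
        if k.1 ≤ i.1 ∧ k.1 ≤ j.1 then ‖geIter A k.1 i j‖ else 0) = MA at *
    generalize (⨆ k : Fin n, ⨆ i : Fin n, ⨆ j : Fin n,
        if k.1 ≤ i.1 ∧ k.1 ≤ j.1 then ‖geIter B k.1 i j‖ else 0) = MB at *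
    generalize (⨆ i : Fin n, ⨆ j : Fin n, ‖B i j‖) = DB at *
    have hc : (0:ℝ) ≤ 4 ^ (n - 1) := by positivity
    generalize (4:ℝ) ^ (n - 1) = c at *
    have s1 : MB / (α + ε) ≤ MB / DB := div_le_div_of_nonneg_left hMB0 hDB0 hDB
    refine le_trans ?_ s1
    obtain ⟨g, rfl⟩ : ∃ g, MA = g * α := ⟨MA / α, by field_simp⟩
    have hg : 0 ≤ g := nonneg_of_mul_nonneg_left hMA0 hα0
    rw [mul_div_assoc, div_self hα0.ne', mul_one, le_div_iff₀ (by linarith)]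
    refine le_trans ?_ (sub_le_iff_le_add.mpr hM)
    have : (g - ε * (c + g) / α) * (α + ε) = g * α - c * ε - ε * ε * (c + g) / α := by
      field_simp
      ring
    rw [this]
    have : 0 ≤ ε * ε * (c + g) / α := by positivity
    linarith
end

section
/- Let 𝕜 be ℝ or ℂ, let n > 1, and let 0 < ε < 2^{−(2n−1)}. Let X be a subset of the n×n matrices over 𝕜 such that for every A ∈ CP_n(𝕜) there exist α ∈ 𝕜 and B ∈ X with |a_{i,j} − α·b_{i,j}| ≤ ε·|a_{1,1}| for all i,j = 1,…,n. Then CP_n(𝕜) ∩ X is non-empty and g[CP_n(𝕜) ∩ X] ≥ (1 − ε·n·4^{n−1}·g[CP_n(𝕜)] / (2ε;4)_n) · g[CP_n(𝕜)]. -/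
open scoped BigOperators

/-- The q-Pochhammer symbol `(a;q)_m`. -/
noncomputable def qPoch (a q : ℝ) (m : ℕ) : ℝ := ∏ i ∈ Finset.range m, (1 - a * q ^ i)

section Helpers

lemma geIter_succ_eq {𝕜 : Type*} [Field 𝕜] {n : ℕ} (A : Matrix (Fin n) (Fin n) 𝕜)
    (K i j : Fin n) (hi : K.1 + 1 ≤ i.1) (hj : K.1 + 1 ≤ j.1) :
    geIter A (K.1 + 1) i j =
      geIter A K.1 i j - geIter A K.1 i K * geIter A K.1 K j / geIter A K.1 K K := by
  simp only [geIter]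
  rw [dif_pos ⟨K.2, hi, hj⟩]

lemma pivotNorm_fin {𝕜 : Type*} [RCLike 𝕜] {n : ℕ} (A : Matrix (Fin n) (Fin n) 𝕜) (K : Fin n) :
    pivotNorm A K.1 = ‖geIter A K.1 K K‖ := by
  simp [pivotNorm, K.2]

/-- `A = L U`, hence the determinant is the product of pivots. -/
lemma det_eq_prod {𝕜 : Type*} [Field 𝕜] {n : ℕ} (A : Matrix (Fin n) (Fin n) 𝕜)
    (hp : ∀ K : Fin n, K.1 + 1 < n → geIter A K.1 K K ≠ 0) :
    A.det = ∏ K : Fin n, geIter A K.1 K K := by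
  set L : Matrix (Fin n) (Fin n) 𝕜 := fun i k =>
    if i = k then 1 else if k < i then geIter A k.1 i k / geIter A k.1 k k else 0 with hL
  set U : Matrix (Fin n) (Fin n) 𝕜 := fun k j =>
    if k ≤ j then geIter A k.1 k j else 0 with hU
  have key : ∀ m : ℕ, ∀ i j : Fin n,
      (if m ≤ i.1 ∧ m ≤ j.1 then geIter A m i j else 0) +
        ∑ k ∈ Finset.range m, (if h : k < n then L i ⟨k, h⟩ * U ⟨k, h⟩ j else 0) = A i j := by
    intro m i j
    induction m with
    | zero => simp [geIter]
    | succ m ih =>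
      rw [Finset.sum_range_succ, ← ih]
      by_cases hm : m < n
      · obtain ⟨K, rfl⟩ : ∃ K : Fin n, K.1 = m := ⟨⟨m, hm⟩, rfl⟩
        rw [dif_pos hm]
        by_cases h1 : K.1 ≤ i.1 ∧ K.1 ≤ j.1
        · rw [if_pos h1]
          by_cases h2 : K.1 + 1 ≤ i.1 ∧ K.1 + 1 ≤ j.1
          · rw [if_pos h2, geIter_succ_eq A K i j h2.1 h2.2]
            have e1 : i ≠ K := by intro h; subst h; omega
            have e2 : K < i := by rw [Fin.lt_def]; omega
            have e3 : K ≤ j := h1.2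
            simp only [hL, hU, Fin.eta, if_neg e1, if_pos e2, if_pos e3]
            ring
          · rw [if_neg h2]
            have e3 : K ≤ j := h1.2
            by_cases e1 : i = K
            · subst e1
              simp only [hL, hU, Fin.eta, if_pos e3, if_true]
              ring
            · have e2 : K < i := lt_of_le_of_ne h1.1 (Ne.symm e1)
              have e4 : j = K := by
                have := Fin.lt_def.1 e2
                apply Fin.ext; omega
              subst e4
              have := hp j (by have := Fin.lt_def.1 e2; omega)
              simp only [hL, hU, Fin.eta, if_neg e1, if_pos e2, le_refl, if_true]
              field_simp
              ring
        · have h2 : ¬ (K.1 + 1 ≤ i.1 ∧ K.1 + 1 ≤ j.1) := by omega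
          rw [if_neg h1, if_neg h2]
          have : L i K * U K j = 0 := by
            by_cases h3 : K ≤ j
            · have e2 : i < K := by rw [Fin.lt_def]; rw [Fin.le_def] at h3; omega
              have : L i K = 0 := by
                simp only [hL, if_neg e2.ne, if_neg e2.not_gt]
              rw [this, zero_mul]
            · simp only [hU, if_neg h3, mul_zero]
          simp only [Fin.eta, this, add_zero]
      · have h1 : ¬ (m ≤ i.1 ∧ m ≤ j.1) := by omega
        have h2 : ¬ (m + 1 ≤ i.1 ∧ m + 1 ≤ j.1) := by omega
        rw [dif_neg hm, if_neg h1, if_neg h2, add_zero]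
  have hLU : A = L * U := by
    ext i j
    rw [← key n i j, if_neg (by omega), zero_add, Matrix.mul_apply, Finset.sum_range]
    apply Finset.sum_congr rfl
    intro k _
    simp [k.2]
  rw [hLU, Matrix.det_mul, Matrix.det_of_isLowerTriangular L, Matrix.det_of_isUpperTriangular, ← hLU]
  · simp [hL, hU]
  · intro i j hij
    have : j < i := hij
    simp only [hU, if_neg this.not_ge]
  · intro i j hij
    have : i < j := by simpa using hij
    simp only [hL, if_neg this.ne, if_neg this.not_gt]

lemma IsCP.pivot_ne {𝕜 : Type*} [RCLike 𝕜] {n : ℕ} {A : Matrix (Fin n) (Fin n) 𝕜}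
    (h : IsCP A) (K : Fin n) : geIter A K.1 K K ≠ 0 := by
  have h1 := det_eq_prod A (fun K hK => by
    have := h.2.1 K.1 hK
    rwa [pivotNorm_fin, norm_ne_zero_iff] at this)
  have h2 := h.1
  rw [h1, Finset.prod_ne_zero_iff] at h2
  exact h2 K (Finset.mem_univ _)

lemma IsCP.le_pivot {𝕜 : Type*} [RCLike 𝕜] {n : ℕ} {A : Matrix (Fin n) (Fin n) 𝕜}
    (h : IsCP A) (K i j : Fin n) (hi : K.1 ≤ i.1) (hj : K.1 ≤ j.1) :
    ‖geIter A K.1 i j‖ ≤ ‖geIter A K.1 K K‖ := by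
  have := h.2.2 K.1 i j hi hj
  rwa [pivotNorm_fin] at this

lemma isCP_of {𝕜 : Type*} [RCLike 𝕜] {n : ℕ} {A : Matrix (Fin n) (Fin n) 𝕜}
    (h1 : ∀ K : Fin n, geIter A K.1 K K ≠ 0)
    (h2 : ∀ K i j : Fin n, K.1 ≤ i.1 → K.1 ≤ j.1 →
      ‖geIter A K.1 i j‖ ≤ ‖geIter A K.1 K K‖) : IsCP A := by
  refine ⟨?_, ?_, ?_⟩
  · rw [det_eq_prod A (fun K _ => h1 K), Finset.prod_ne_zero_iff]
    exact fun K _ => h1 K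
  · intro k hk
    have := pivotNorm_fin A ⟨k, by omega⟩
    simp only at this
    rw [this, norm_ne_zero_iff]
    exact h1 ⟨k, by omega⟩
  · intro k i j hi hj
    have := pivotNorm_fin A ⟨k, by omega⟩
    simp only at this
    rw [this]
    exact h2 ⟨k, by omega⟩ i j hi hj

lemma geIter_smul {𝕜 : Type*} [Field 𝕜] {n : ℕ} (A B : Matrix (Fin n) (Fin n) 𝕜) (α : 𝕜)
    (hα : α ≠ 0) (hB : ∀ i j, B i j = α * A i j) (k : ℕ) (i j : Fin n) :
    geIter B k i j = α * geIter A k i j := by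
  induction k generalizing i j with
  | zero => exact hB i j
  | succ k ih =>
    simp only [geIter]
    split_ifs with h
    · rw [ih, ih, ih, ih, mul_sub]
      congr 1
      rw [show α * geIter A k i ⟨k, h.1⟩ * (α * geIter A k ⟨k, h.1⟩ j) =
        α * (α * (geIter A k i ⟨k, h.1⟩ * geIter A k ⟨k, h.1⟩ j)) by ring,
        mul_div_mul_left _ _ hα, mul_div_assoc]
    · exact ih i j

/-- The denominator of the growth factor of a completely pivoted matrix. -/
lemma IsCP.denom {𝕜 : Type*} [RCLike 𝕜] {n : ℕ} {A : Matrix (Fin n) (Fin n) 𝕜}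
    (h : IsCP A) (z : Fin n) (hz : z.1 = 0) :
    (⨆ i : Fin n, ⨆ j : Fin n, ‖A i j‖) = ‖A z z‖ := by
  have : Nonempty (Fin n) := ⟨z⟩
  apply le_antisymm
  · refine ciSup_le fun i => ciSup_le fun j => ?_
    have := h.le_pivot z i j (by omega) (by omega)
    rwa [hz] at this
  · refine le_trans ?_ (le_ciSup (Set.finite_range _).bddAbove z)
    exact le_ciSup (f := fun j => ‖A z j‖) (Set.finite_range _).bddAbove z

lemma IsCP.growth_ge {𝕜 : Type*} [RCLike 𝕜] {n : ℕ} {A : Matrix (Fin n) (Fin n) 𝕜}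
    (h : IsCP A) (z : Fin n) (hz : z.1 = 0) (K : Fin n) :
    ‖geIter A K.1 K K‖ / ‖A z z‖ ≤ growth A := by
  unfold growth
  rw [h.denom z hz]
  gcongr
  refine le_trans ?_ (le_ciSup (Set.finite_range _).bddAbove K)
  refine le_trans ?_ (le_ciSup (Set.finite_range _).bddAbove K)
  refine le_trans ?_ (le_ciSup (Set.finite_range _).bddAbove K)
  simp

lemma IsCP.growth_le {𝕜 : Type*} [RCLike 𝕜] {n : ℕ} {A : Matrix (Fin n) (Fin n) 𝕜}
    (h : IsCP A) (z : Fin n) (hz : z.1 = 0) (M : ℝ)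
    (hM : ∀ K : Fin n, ‖geIter A K.1 K K‖ ≤ M) :
    growth A ≤ M / ‖A z z‖ := by
  have : Nonempty (Fin n) := ⟨z⟩
  unfold growth
  rw [h.denom z hz]
  gcongr
  refine ciSup_le fun K => ciSup_le fun i => ciSup_le fun j => ?_
  split_ifs with hc
  · exact (h.le_pivot K i j hc.1 hc.2).trans (hM K)
  · exact (norm_nonneg _).trans (hM K)

lemma norm_schur_le {𝕜 : Type*} [RCLike 𝕜] {x y z w : 𝕜} {M : ℝ} (hw : w ≠ 0) (hx : ‖x‖ ≤ M)
    (hy : ‖y‖ ≤ ‖w‖) (hz : ‖z‖ ≤ M) : ‖x - y * z / w‖ ≤ 2 * M := by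
  have hw' : 0 < ‖w‖ := norm_pos_iff.2 hw
  have : ‖y * z / w‖ ≤ M := by
    rw [norm_div, norm_mul, div_le_iff₀ hw']
    have hM := (norm_nonneg z).trans hz
    nlinarith [mul_le_mul hy hz (norm_nonneg _) (norm_nonneg _)]
  linarith [norm_sub_le x (y * z / w)]

lemma IsCP.geIter_le {𝕜 : Type*} [RCLike 𝕜] {n : ℕ} {A : Matrix (Fin n) (Fin n) 𝕜}
    (h : IsCP A) (z : Fin n) (hz : z.1 = 0) (k : ℕ) (i j : Fin n) (hi : k ≤ i.1) (hj : k ≤ j.1) :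
    ‖geIter A k i j‖ ≤ 2 ^ k * ‖A z z‖ := by
  induction k generalizing i j with
  | zero =>
    have := h.le_pivot z i j (by omega) (by omega)
    rw [hz] at this
    rw [pow_zero, one_mul]
    exact this
  | succ k ih =>
    have e := geIter_succ_eq A ⟨k, by omega⟩ i j hi hj
    simp only at e
    rw [e, pow_succ, mul_comm (2 ^ k) (2 : ℝ), mul_assoc]
    exact norm_schur_le (h.pivot_ne ⟨k, by omega⟩) (ih i j (by omega) (by omega))
      (h.le_pivot ⟨k, by omega⟩ i ⟨k, by omega⟩ (by simp; omega) le_rfl)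
      (ih _ j (by simp) (by omega))

lemma bddAbove_growth {𝕜 : Type*} [RCLike 𝕜] {n : ℕ} (hn : 1 < n) :
    BddAbove (growth '' {A : Matrix (Fin n) (Fin n) 𝕜 | IsCP A}) := by
  refine ⟨2 ^ n, ?_⟩
  rintro _ ⟨A, hA, rfl⟩
  have hA : IsCP A := hA
  have h0 : A ⟨0, by omega⟩ ⟨0, by omega⟩ ≠ 0 := hA.pivot_ne ⟨0, by omega⟩
  have := hA.growth_le ⟨0, by omega⟩ rfl (2 ^ n * ‖A ⟨0, by omega⟩ ⟨0, by omega⟩‖) (fun K => by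
    refine (hA.geIter_le ⟨0, by omega⟩ rfl K.1 K K le_rfl le_rfl).trans ?_
    gcongr
    · norm_num
    · exact K.2.le)
  rwa [mul_div_assoc, div_self (norm_ne_zero_iff.2 h0), mul_one] at this

lemma isCP_one {𝕜 : Type*} [RCLike 𝕜] {n : ℕ} : IsCP (1 : Matrix (Fin n) (Fin n) 𝕜) := by
  have key : ∀ (k : ℕ) (i j : Fin n), geIter (1 : Matrix (Fin n) (Fin n) 𝕜) k i j =
      (1 : Matrix (Fin n) (Fin n) 𝕜) i j := by
    intro k
    induction k with
    | zero => intro i j; rfl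
    | succ k ih =>
      intro i j
      simp only [geIter]
      split_ifs with h
      · rw [ih, ih, ih, ih]
        have : i ≠ ⟨k, h.1⟩ := by intro e; rw [e] at h; simp at h
        rw [Matrix.one_apply_ne this]
        simp
      · exact ih i j
  refine isCP_of (fun K => by rw [key]; simp) (fun K i j _ _ => ?_)
  rw [key, key]
  by_cases h : i = j
  · subst h; simp
  · rw [Matrix.one_apply_ne h]; simp

/-- The coefficient of the modification. -/
noncomputable def modCoef {n : ℕ} (s : Fin n → ℝ) (i j : Fin n) : ℝ :=
  if i = j then s i ^ 2 - 1 else s (min i j) - 1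

/-- The modified matrix, whose pivots dominate with a margin. -/
noncomputable def modMat {𝕜 : Type*} [RCLike 𝕜] {n : ℕ} (A : Matrix (Fin n) (Fin n) 𝕜)
    (c : ℝ) (s : Fin n → ℝ) : Matrix (Fin n) (Fin n) 𝕜 := fun i j =>
  (c : 𝕜) * (A i j + (modCoef s i j : 𝕜) * geIter A (min i j).1 i j)

lemma geIter_modMat {𝕜 : Type*} [RCLike 𝕜] {n : ℕ} (A : Matrix (Fin n) (Fin n) 𝕜)
    (c : ℝ) (s : Fin n → ℝ) (hc : c ≠ 0) (hs : ∀ K, s K ≠ 0)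
    (hp : ∀ K : Fin n, geIter A K.1 K K ≠ 0) (k : ℕ) (i j : Fin n) (hi : k ≤ i.1) (hj : k ≤ j.1) :
    geIter (modMat A c s) k i j =
      (c : 𝕜) * (geIter A k i j + (modCoef s i j : 𝕜) * geIter A (min i j).1 i j) := by
  induction k generalizing i j with
  | zero => rfl
  | succ k ih =>
    obtain ⟨K, rfl⟩ : ∃ K : Fin n, K.1 = k := ⟨⟨k, by omega⟩, rfl⟩
    have hKi : K < i := by rw [Fin.lt_def]; omega
    have hKj : K < j := by rw [Fin.lt_def]; omega
    rw [geIter_succ_eq _ K i j hi hj, geIter_succ_eq _ K i j hi hj,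
      ih i j (by omega) (by omega), ih i K (by omega) le_rfl, ih K j le_rfl (by omega),
      ih K K le_rfl le_rfl]
    have m1 : min i K = K := min_eq_right hKi.le
    have m2 : min K j = K := min_eq_left hKj.le
    have c1 : modCoef s i K = s K - 1 := by simp [modCoef, hKi.ne', m1]
    have c2 : modCoef s K j = s K - 1 := by simp [modCoef, hKj.ne, m2]
    have c3 : modCoef s K K = s K ^ 2 - 1 := by simp [modCoef]
    rw [m1, m2, c1, c2, c3, min_self]
    have hc' : (c : 𝕜) ≠ 0 := by exact_mod_cast hc
    have hs' : (s K : 𝕜) ≠ 0 := by exact_mod_cast hs K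
    have hp' := hp K
    push_cast
    have e : (c : 𝕜) * (geIter A K.1 K K + ((s K : 𝕜) ^ 2 - 1) * geIter A K.1 K K) =
      c * (s K) ^ 2 * geIter A K.1 K K := by ring
    rw [e]
    field_simp
    ring

/-- Error propagation in one step of Gaussian elimination. -/
lemma schur_err {𝕜 : Type*} [RCLike 𝕜] {x y z w x' y' z' w' : 𝕜} {e : ℝ} (hw : w ≠ 0)
    (hw' : w' ≠ 0) (hz : ‖z‖ ≤ ‖w‖) (hy' : ‖y'‖ ≤ ‖w'‖) (h1 : ‖x' - x‖ ≤ e)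
    (h2 : ‖y' - y‖ ≤ e) (h3 : ‖z' - z‖ ≤ e) (h4 : ‖w' - w‖ ≤ e) :
    ‖(x' - y' * z' / w') - (x - y * z / w)‖ ≤ 4 * e := by
  have he : 0 ≤ e := (norm_nonneg _).trans h1
  have hwn : 0 < ‖w‖ := norm_pos_iff.2 hw
  have hwn' : 0 < ‖w'‖ := norm_pos_iff.2 hw'
  have id : (x' - y' * z' / w') - (x - y * z / w) =
      (x' - x) - ((y' - y) * (z / w) + (y' / w') * ((z' - z) - (z / w) * (w' - w))) := by
    field_simp
    ring
  have q1 : ‖z / w‖ ≤ 1 := by rw [norm_div]; exact div_le_one_of_le₀ hz hwn.le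
  have q2 : ‖y' / w'‖ ≤ 1 := by rw [norm_div]; exact div_le_one_of_le₀ hy' hwn'.le
  have r1 : ‖(y' - y) * (z / w)‖ ≤ e * 1 := by
    rw [norm_mul]; exact mul_le_mul h2 q1 (norm_nonneg _) he
  have r2 : ‖(z / w) * (w' - w)‖ ≤ 1 * e := by
    rw [norm_mul]; exact mul_le_mul q1 h4 (norm_nonneg _) zero_le_one
  have r3 : ‖(z' - z) - (z / w) * (w' - w)‖ ≤ 2 * e := by
    linarith [norm_sub_le (z' - z) ((z / w) * (w' - w))]
  have r4 : ‖(y' / w') * ((z' - z) - (z / w) * (w' - w))‖ ≤ 1 * (2 * e) := by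
    rw [norm_mul]; exact mul_le_mul q2 r3 (norm_nonneg _) zero_le_one
  rw [id]
  have := norm_sub_le (x' - x)
    ((y' - y) * (z / w) + (y' / w') * ((z' - z) - (z / w) * (w' - w)))
  have := norm_add_le ((y' - y) * (z / w)) ((y' / w') * ((z' - z) - (z / w) * (w' - w)))
  linarith

/-- Stability of complete pivoting with a margin. -/
lemma perturb_s7 {𝕜 : Type*} [RCLike 𝕜] {n : ℕ} (T B : Matrix (Fin n) (Fin n) 𝕜) (E : ℝ)
    (hE : 0 ≤ E) (hpiv : ∀ K : Fin n, 4 ^ K.1 * E < ‖geIter T K.1 K K‖)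
    (hgap : ∀ K i j : Fin n, K ≤ i → K ≤ j → ¬ (i = K ∧ j = K) →
      ‖geIter T K.1 i j‖ + 2 * (4 ^ K.1 * E) ≤ ‖geIter T K.1 K K‖)
    (hB : ∀ i j, ‖B i j - T i j‖ ≤ E) :
    IsCP B ∧ ∀ K : Fin n, ‖geIter B K.1 K K - geIter T K.1 K K‖ ≤ 4 ^ K.1 * E := by
  have step1 : ∀ K : Fin n, (∀ i j : Fin n, K.1 ≤ i.1 → K.1 ≤ j.1 →
      ‖geIter B K.1 i j - geIter T K.1 i j‖ ≤ 4 ^ K.1 * E) →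
      geIter B K.1 K K ≠ 0 ∧ ∀ i j : Fin n, K.1 ≤ i.1 → K.1 ≤ j.1 →
        ‖geIter B K.1 i j‖ ≤ ‖geIter B K.1 K K‖ := by
    intro K h
    have h0 := h K K le_rfl le_rfl
    have h1 := hpiv K
    have h2 : ‖geIter T K.1 K K‖ ≤ ‖geIter B K.1 K K‖ + 4 ^ K.1 * E := by
      have := norm_sub_norm_le (geIter T K.1 K K) (geIter B K.1 K K)
      rw [norm_sub_rev] at this
      linarith
    refine ⟨?_, ?_⟩
    · rw [← norm_pos_iff]; linarith
    · intro i j hi hj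
      by_cases hij : i = K ∧ j = K
      · rw [hij.1, hij.2]
      · have h3 := hgap K i j hi hj hij
        have h4 := h i j hi hj
        have h5 := norm_sub_norm_le (geIter B K.1 i j) (geIter T K.1 i j)
        linarith
  have err : ∀ k : ℕ, ∀ i j : Fin n, k ≤ i.1 → k ≤ j.1 →
      ‖geIter B k i j - geIter T k i j‖ ≤ 4 ^ k * E := by
    intro k
    induction k with
    | zero => intro i j _ _; simpa [geIter] using hB i j
    | succ k ih =>
      intro i j hi hj
      obtain ⟨K, rfl⟩ : ∃ K : Fin n, K.1 = k := ⟨⟨k, by omega⟩, rfl⟩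
      have hs := step1 K ih
      have hT : ‖geIter T K.1 K j‖ ≤ ‖geIter T K.1 K K‖ := by
        have := hgap K K j le_rfl (by rw [Fin.le_def]; omega) (by rintro ⟨_, rfl⟩; omega)
        have : 0 ≤ 4 ^ K.1 * E := by positivity
        linarith
      have hT0 : geIter T K.1 K K ≠ 0 := by
        rw [← norm_pos_iff]
        have := hpiv K
        have : 0 ≤ 4 ^ K.1 * E := by positivity
        linarith
      rw [geIter_succ_eq _ K i j hi hj, geIter_succ_eq _ K i j hi hj, pow_succ,
        mul_comm (4 ^ K.1) (4 : ℝ), mul_assoc]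
      exact schur_err hT0 hs.1 hT (hs.2 i K (by omega) le_rfl) (ih i j (by omega) (by omega))
        (ih i K (by omega) le_rfl) (ih K j le_rfl (by omega)) (ih K K le_rfl le_rfl)
  refine ⟨isCP_of (fun K => (step1 K (err K.1)).1) (fun K => (step1 K (err K.1)).2), ?_⟩
  exact fun K => err K.1 K K le_rfl le_rfl

/-- Given a completely pivoted `A`, there is a strongly completely pivoted nearby matrix. -/
lemma exists_strong {𝕜 : Type*} [RCLike 𝕜] {n : ℕ} (A : Matrix (Fin n) (Fin n) 𝕜)
    (hA : IsCP A) (c : ℝ) (hc : 0 < c) (E : ℝ) (hE : 0 < E) (D : ℕ → ℝ)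
    (hD1 : ∀ k, k < n → 4 ^ k * E ≤ D k) (hD2 : ∀ k l, k < l → l < n → D l + 2 * (4 ^ k * E) ≤ D k)
    (hD3 : ∀ k, k + 1 < n → 4 * (4 ^ k * E) ≤ D k) :
    ∃ T : Matrix (Fin n) (Fin n) 𝕜,
      (∀ K : Fin n, ‖geIter T K.1 K K‖ = c * ‖geIter A K.1 K K‖ + D K.1) ∧
      (∀ K i j : Fin n, K ≤ i → K ≤ j → ¬ (i = K ∧ j = K) →
        ‖geIter T K.1 i j‖ + 2 * (4 ^ K.1 * E) ≤ ‖geIter T K.1 K K‖) := by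
  have hp := hA.pivot_ne
  have hpn : ∀ K : Fin n, 0 < ‖geIter A K.1 K K‖ := fun K => norm_pos_iff.2 (hp K)
  have hD0 : ∀ K : Fin n, 0 < D K.1 := fun K =>
    lt_of_lt_of_le (by positivity) (hD1 K.1 K.2)
  obtain ⟨s, hs⟩ : ∃ s : Fin n → ℝ, ∀ K, 1 ≤ s K ∧
      c * s K ^ 2 * ‖geIter A K.1 K K‖ = c * ‖geIter A K.1 K K‖ + D K.1 := by
    refine ⟨fun K => Real.sqrt (1 + D K.1 / (c * ‖geIter A K.1 K K‖)), fun K => ?_⟩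
    have h1 := hpn K
    have h2 := hD0 K
    have h3 : 0 < D K.1 / (c * ‖geIter A K.1 K K‖) := by positivity
    refine ⟨Real.one_le_sqrt.2 (by linarith), ?_⟩
    rw [Real.sq_sqrt (by linarith)]
    field_simp
  have hg := geIter_modMat A c s hc.ne' (fun K => by linarith [(hs K).1]) hp
  have hpiv : ∀ K : Fin n, ‖geIter (modMat A c s) K.1 K K‖ =
      c * ‖geIter A K.1 K K‖ + D K.1 := by
    intro K
    rw [hg K.1 K K le_rfl le_rfl, min_self, ← (hs K).2]
    have : (c : 𝕜) * (geIter A K.1 K K + (modCoef s K K : 𝕜) * geIter A K.1 K K) =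
        ((c * s K ^ 2 : ℝ) : 𝕜) * geIter A K.1 K K := by
      simp only [modCoef, if_true]; push_cast; ring
    rw [this, norm_mul, RCLike.norm_ofReal, abs_of_nonneg (by positivity)]
  -- bound for the extra term
  have hextra : ∀ i j : Fin n, c * (|modCoef s i j| * ‖geIter A (min i j).1 i j‖) ≤
      D (min i j).1 := by
    intro i j
    set m := min i j with hm
    have hle : ‖geIter A m.1 i j‖ ≤ ‖geIter A m.1 m m‖ :=
      hA.le_pivot m i j (Fin.le_def.1 (min_le_left i j)) (Fin.le_def.1 (min_le_right i j))
    have h1 := (hs m).1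
    have h2 := (hs m).2
    have hcoef : |modCoef s i j| ≤ s m ^ 2 - 1 := by
      unfold modCoef
      split_ifs with h
      · subst h
        rw [min_self] at hm
        rw [hm, abs_of_nonneg (by rw [hm] at h1; nlinarith)]
      · rw [← hm, abs_of_nonneg (by linarith)]
        nlinarith
    have h3 : |modCoef s i j| * ‖geIter A m.1 i j‖ ≤ (s m ^ 2 - 1) * ‖geIter A m.1 m m‖ :=
      mul_le_mul hcoef hle (norm_nonneg _) (by nlinarith)
    have h4 := mul_le_mul_of_nonneg_left h3 hc.le
    linarith
  refine ⟨modMat A c s, hpiv, ?_⟩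
  intro K i j hi hj hij
  rw [hpiv K, hg K.1 i j hi hj]
  by_cases hK : min i j = K
  · -- row or column of the pivot
    have hne : i ≠ j := by
      rintro rfl
      rw [min_self] at hK
      exact hij ⟨hK, hK⟩
    have hco : modCoef s i j = s K - 1 := by simp [modCoef, hne, hK]
    rw [hco, hK]
    have e : (c : 𝕜) * (geIter A K.1 i j + ((s K - 1 : ℝ) : 𝕜) * geIter A K.1 i j) =
        ((c * s K : ℝ) : 𝕜) * geIter A K.1 i j := by push_cast; ring
    have h1 := (hs K).1
    have h2 := (hs K).2
    rw [e, norm_mul, RCLike.norm_ofReal, abs_of_nonneg (by positivity)]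
    have hle := hA.le_pivot K i j hi hj
    have hKn : K.1 + 1 < n := by
      have hi' := Fin.le_def.1 hi
      have hj' := Fin.le_def.1 hj
      by_contra hcon
      exact hij ⟨Fin.ext (by omega), Fin.ext (by omega)⟩
    have h3 := hD3 K.1 hKn
    have h4 : c * s K * ‖geIter A K.1 i j‖ ≤ c * s K * ‖geIter A K.1 K K‖ := by gcongr
    have h5 : 0 ≤ c * ‖geIter A K.1 K K‖ * (s K - 1) ^ 2 := by
      have := hpn K; positivity
    nlinarith
  · have hlt : K < min i j := lt_of_le_of_ne (le_min hi hj) (Ne.symm hK)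
    have h1 := hD2 K.1 (min i j).1 hlt (min i j).2
    have h2 := hextra i j
    have h3 := hA.le_pivot K i j hi hj
    rw [norm_mul, RCLike.norm_ofReal, abs_of_pos hc]
    have h4 := norm_add_le (geIter A K.1 i j) ((modCoef s i j : 𝕜) * geIter A (min i j).1 i j)
    rw [norm_mul, RCLike.norm_ofReal] at h4
    have h5 := mul_le_mul_of_nonneg_left h4 hc.le
    have h6 := mul_le_mul_of_nonneg_left h3 hc.le
    linarith

/-- For each completely pivoted `A`, the set `X` has a completely pivoted matrix of almost the
same growth. -/
lemma exists_in_cover {𝕜 : Type*} [RCLike 𝕜] {n : ℕ} (hn : 1 < n) (z : Fin n) (hz : z.1 = 0)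
    (ε : ℝ) (hε0 : 0 < ε) (hε1 : 2 * (4 ^ (n - 1) * ε) < 1)
    (X : Set (Matrix (Fin n) (Fin n) 𝕜))
    (hX : ∀ A : Matrix (Fin n) (Fin n) 𝕜, IsCP A →
      ∃ α : 𝕜, ∃ B ∈ X, ∀ i j : Fin n,
        ‖A i j - α * B i j‖ ≤ ε * ‖A z z‖)
    (A : Matrix (Fin n) (Fin n) 𝕜) (hA : IsCP A) :
    ∃ B ∈ X, IsCP B ∧ (1 - 2 * (4 ^ (n - 1) * ε)) * growth A ≤ growth B := by
  obtain rfl : z = ⟨0, zero_lt_one.trans hn⟩ := Fin.ext hz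
  clear hz
  set z : Fin n := ⟨0, zero_lt_one.trans hn⟩ with hz
  have hP : 0 < ‖A z z‖ := norm_pos_iff.2 (hA.pivot_ne z)
  set P := ‖A z z‖ with hPdef
  set N : ℝ := 4 ^ (n - 1) with hN
  have hN1 : 1 ≤ N := one_le_pow₀ (by norm_num)
  have hkN : ∀ k, k < n → (4 : ℝ) ^ k ≤ N := fun k hk =>
    pow_le_pow_right₀ (by norm_num) (by omega)
  set c : ℝ := 1 - (N + 2 / 3 * (N - 1)) * ε with hcdef
  have hc : 0 < c := by rw [hcdef]; nlinarith
  have hE : 0 < ε * P := by positivity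
  obtain ⟨T, hT1, hT2⟩ := exists_strong A hA c hc (ε * P) hE
    (fun k => (N + 2 / 3 * (N - 4 ^ k)) * (ε * P))
    (fun k hk => by
      have := hkN k hk
      apply mul_le_mul_of_nonneg_right _ hE.le
      linarith)
    (fun k l hkl hl => by
      have : (4 : ℝ) ^ (k + 1) ≤ 4 ^ l := pow_le_pow_right₀ (by norm_num) (by omega)
      rw [pow_succ] at this
      rw [← mul_assoc 2, ← add_mul]
      apply mul_le_mul_of_nonneg_right _ hE.le
      linarith)
    (fun k hk => by
      have := hkN (k + 1) hk
      have h4 : (0 : ℝ) < 4 ^ k := by positivity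
      rw [pow_succ] at this
      rw [← mul_assoc]
      apply mul_le_mul_of_nonneg_right _ hE.le
      linarith)
  have hTpiv : ∀ K : Fin n, c * ‖geIter A K.1 K K‖ + 4 ^ K.1 * (ε * P) ≤ ‖geIter T K.1 K K‖ := by
    intro K
    rw [hT1 K]
    have := hkN K.1 K.2
    have : 4 ^ K.1 * (ε * P) ≤ (N + 2 / 3 * (N - 4 ^ K.1)) * (ε * P) := by
      apply mul_le_mul_of_nonneg_right _ hE.le
      linarith
    linarith
  have hTlt : ∀ K : Fin n, 4 ^ K.1 * (ε * P) < ‖geIter T K.1 K K‖ := by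
    intro K
    have h1 := hTpiv K
    have h2 : 0 < c * ‖geIter A K.1 K K‖ := mul_pos hc (norm_pos_iff.2 (hA.pivot_ne K))
    linarith
  have hTz : ‖T z z‖ = P := by
    have := hT1 z
    simp only [hz, geIter, pow_zero] at this
    rw [← hz, ← hPdef] at this
    rw [this, hcdef]; ring
  have hTCP : IsCP T := by
    refine isCP_of (fun K => ?_) (fun K i j hi hj => ?_)
    · rw [← norm_pos_iff]
      have := hTlt K
      have : 0 < 4 ^ K.1 * (ε * P) := by positivity
      linarith
    · by_cases hij : i = K ∧ j = K
      · rw [hij.1, hij.2]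
      · have := hT2 K i j hi hj hij
        have : 0 < 4 ^ K.1 * (ε * P) := by positivity
        linarith
  obtain ⟨α, B, hBX, hB⟩ := hX T hTCP
  rw [hTz] at hB
  have hNε : ε ≤ N * ε := by nlinarith
  have hα : α ≠ 0 := by
    rintro rfl
    have := hB z z
    rw [zero_mul, sub_zero, hTz] at this
    nlinarith
  set C : Matrix (Fin n) (Fin n) 𝕜 := fun i j => α * B i j with hC
  have hCB := geIter_smul B C α hα (fun i j => rfl)
  obtain ⟨hC1, hC2⟩ := perturb_s7 T C (ε * P) hE.le hTlt hT2
    (fun i j => by rw [norm_sub_rev]; exact hB i j)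
  have hαn : 0 < ‖α‖ := norm_pos_iff.2 hα
  have hBCP : IsCP B := by
    refine isCP_of (fun K => ?_) (fun K i j hi hj => ?_)
    · have := hC1.pivot_ne K
      rw [hCB] at this
      exact right_ne_zero_of_mul this
    · have := hC1.le_pivot K i j hi hj
      rw [hCB, hCB, norm_mul, norm_mul] at this
      exact le_of_mul_le_mul_left this hαn
  refine ⟨B, hBX, hBCP, ?_⟩
  have hBz : 0 < ‖B z z‖ := norm_pos_iff.2 (hBCP.pivot_ne z)
  have hαB : ‖α‖ * ‖B z z‖ ≤ (1 + ε) * P := by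
    have h1 := hB z z
    have h2 := norm_sub_norm_le (α * B z z) (T z z)
    rw [norm_sub_rev, norm_mul, hTz] at h2
    linarith
  -- all pivots of `A` are bounded in terms of the growth of `B`
  have hM : ∀ K : Fin n, ‖geIter A K.1 K K‖ ≤ growth B * ((1 + ε) * P) / c := by
    intro K
    have h1 := hTpiv K
    have h2 := hC2 K
    have h3 := norm_sub_norm_le (geIter T K.1 K K) (geIter C K.1 K K)
    rw [norm_sub_rev] at h3
    rw [hCB, norm_mul] at h3
    rw [hCB] at h2
    have h4 := hBCP.growth_ge z rfl K
    rw [div_le_iff₀ hBz] at h4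
    have h5 : ‖α‖ * ‖geIter B K.1 K K‖ ≤ ‖α‖ * (growth B * ‖B z z‖) := by gcongr
    have h0 : 0 ≤ growth B := by
      refine le_trans ?_ (hBCP.growth_ge z rfl K)
      positivity
    have h6 := mul_le_mul_of_nonneg_left hαB h0
    rw [le_div_iff₀ hc]
    nlinarith
  have h0 : 0 ≤ growth B := by
    refine le_trans ?_ (hBCP.growth_ge z rfl z)
    positivity
  have hg := hA.growth_le z rfl _ hM
  rw [← hPdef] at hg
  have hg' : growth A * c ≤ growth B * (1 + ε) := by
    have : growth B * ((1 + ε) * P) / c / P = growth B * (1 + ε) / c := by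
      field_simp
    rw [this, le_div_iff₀ hc] at hg
    exact hg
  have hA0 : 0 ≤ growth A := by
    refine le_trans ?_ (hA.growth_ge z rfl z)
    positivity
  have hcc : (1 - 2 * (N * ε)) * (1 + ε) ≤ c := by
    rw [hcdef]; nlinarith
  have h7 : (1 - 2 * (N * ε)) * growth A * (1 + ε) ≤ growth B * (1 + ε) := by
    nlinarith [mul_le_mul_of_nonneg_left hcc hA0]
  exact le_of_mul_le_mul_right h7 (by linarith)

end Helpers

/-- if `X` covers `CP_n(𝕜)` up to scaling and entrywise error
`ε·|a_{1,1}|`, then `CP_n(𝕜) ∩ X` is nonempty with nearly maximal growth. -/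
theorem cp_cover_growth {𝕜 : Type*} [RCLike 𝕜] {n : ℕ} (hn : 1 < n)
    (ε : ℝ) (hε0 : 0 < ε) (hε1 : ε < ((2 : ℝ) ^ (2 * n - 1))⁻¹)
    (X : Set (Matrix (Fin n) (Fin n) 𝕜))
    (hX : ∀ A : Matrix (Fin n) (Fin n) 𝕜, IsCP A →
      ∃ α : 𝕜, ∃ B ∈ X, ∀ i j : Fin n,
        ‖A i j - α * B i j‖ ≤ ε * ‖A ⟨0, by omega⟩ ⟨0, by omega⟩‖) :
    (∃ B ∈ X, IsCP B) ∧
      (1 - ε * n * 4 ^ (n - 1) * gCP 𝕜 n / qPoch (2 * ε) 4 n) * gCP 𝕜 n ≤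
        sSup (growth '' {A : Matrix (Fin n) (Fin n) 𝕜 | IsCP A ∧ A ∈ X}) := by
  obtain ⟨m, rfl⟩ : ∃ m, n = m + 1 := ⟨n - 1, by omega⟩
  have hsmall : 2 * ((4 : ℝ) ^ (m + 1 - 1) * ε) < 1 := by
    have e : (2 : ℝ) ^ (2 * (m + 1) - 1) = 2 * 4 ^ (m + 1 - 1) := by
      rw [show 2 * (m + 1) - 1 = 2 * m + 1 by omega, pow_succ, pow_mul]
      norm_num
      ring
    rw [e, lt_inv_comm₀ hε0 (by positivity), lt_inv_comm₀ (by positivity) hε0,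
      ← one_div, lt_div_iff₀ (by positivity)] at hε1
    linarith
  have hmain := exists_in_cover hn _ rfl ε hε0 hsmall X hX
  obtain ⟨B₀, hB₀X, hB₀, -⟩ := hmain 1 isCP_one
  refine ⟨⟨B₀, hB₀X, hB₀⟩, ?_⟩
  set N : ℝ := 4 ^ (m + 1 - 1) with hN
  have hNpos : 0 < N := by positivity
  have hbdd := bddAbove_growth (𝕜 := 𝕜) hn
  have hbddX : BddAbove (growth '' {A : Matrix (Fin (m + 1)) (Fin (m + 1)) 𝕜 | IsCP A ∧ A ∈ X}) :=
    hbdd.mono (Set.image_mono fun A hA => hA.1)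
  set S := sSup (growth '' {A : Matrix (Fin (m + 1)) (Fin (m + 1)) 𝕜 | IsCP A ∧ A ∈ X}) with hS
  -- `1 ≤ G`
  have hG1 : 1 ≤ gCP 𝕜 (m + 1) := by
    have h1 : growth (1 : Matrix (Fin (m + 1)) (Fin (m + 1)) 𝕜) ≤ gCP 𝕜 (m + 1) :=
      le_csSup hbdd ⟨1, isCP_one, rfl⟩
    have h2 := (isCP_one (𝕜 := 𝕜) (n := m + 1)).growth_ge ⟨0, by omega⟩ rfl ⟨0, by omega⟩
    simp only [geIter] at h2
    rw [div_self (by simp)] at h2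
    linarith
  have hlow : (1 - 2 * (N * ε)) * gCP 𝕜 (m + 1) ≤ S := by
    have hpos : 0 < 1 - 2 * (N * ε) := by linarith
    rw [mul_comm, ← le_div_iff₀ hpos]
    refine csSup_le ⟨_, 1, isCP_one, rfl⟩ ?_
    rintro _ ⟨A, hA, rfl⟩
    obtain ⟨B, hBX, hB, hg⟩ := hmain A hA
    rw [le_div_iff₀ hpos, mul_comm]
    exact hg.trans (le_csSup hbddX ⟨B, ⟨hB, hBX⟩, rfl⟩)
  -- the Pochhammer symbol lies in `(0, 1]`
  have hterm : ∀ i ∈ Finset.range (m + 1), 0 < 1 - 2 * ε * (4 : ℝ) ^ i ∧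
      1 - 2 * ε * (4 : ℝ) ^ i ≤ 1 := by
    intro i hi
    have hi' := Finset.mem_range.1 hi
    have h1 : (4 : ℝ) ^ i ≤ N := pow_le_pow_right₀ (by norm_num) (by omega)
    have h2 : 0 < 2 * ε * (4 : ℝ) ^ i := by positivity
    refine ⟨?_, by linarith⟩
    nlinarith
  have hq0 : 0 < qPoch (2 * ε) 4 (m + 1) := Finset.prod_pos fun i hi => (hterm i hi).1
  have hq1 : qPoch (2 * ε) 4 (m + 1) ≤ 1 :=
    Finset.prod_le_one (fun i hi => (hterm i hi).1.le) fun i hi => (hterm i hi).2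
  refine le_trans ?_ hlow
  refine mul_le_mul_of_nonneg_right ?_ (by linarith)
  have hn2 : (2 : ℝ) ≤ ((m + 1 : ℕ) : ℝ) := by exact_mod_cast hn
  have h3 : 2 * (N * ε) ≤ ε * ((m + 1 : ℕ) : ℝ) * N * gCP 𝕜 (m + 1) := by
    have a1 : 2 * (N * ε) ≤ ((m + 1 : ℕ) : ℝ) * (N * ε) := by gcongr
    have a2 : ((m + 1 : ℕ) : ℝ) * (N * ε) * 1 ≤ ((m + 1 : ℕ) : ℝ) * (N * ε) * gCP 𝕜 (m + 1) := by
      gcongr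
    linarith
  have h4 : ε * ((m + 1 : ℕ) : ℝ) * N * gCP 𝕜 (m + 1) ≤
      ε * ((m + 1 : ℕ) : ℝ) * N * gCP 𝕜 (m + 1) / qPoch (2 * ε) 4 (m + 1) := by
    apply le_div_self _ hq0 hq1
    have : 0 < N * ε := by positivity
    linarith
  linarith
end

section
/- Let A be a real n×n matrix with a partially pivoted floating-point elimination trajectory (Â^{(k)}) with unit round-off u. Then there exists a matrix B ∈ PP_n(ℝ) (exact arithmetic) such that b^{(k)}_{i,j} = â^{(k)}_{i,j} whenever i = k or j = k, and |â^{(k)}_{i,j} − b^{(k)}_{i,j}| ≤ u · Σ_{ℓ=k}^{min(i,j)−1} [ |â^{(ℓ)}_{i,j}| + |â^{(ℓ)}_{ℓ,j}|·(3 + u) ] for all i,j = k,…,n and k = 1,…,n−1. -/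
open scoped BigOperators

/-- `A` is partially pivoted: `A ∈ PP_n(ℝ)`. -/
def IsPP {n : ℕ} (A : Matrix (Fin n) (Fin n) ℝ) : Prop :=
  A.det ≠ 0 ∧ (∀ k : ℕ, k + 1 < n → pivotNorm A k ≠ 0) ∧
    ∀ (k : ℕ) (hk : k < n) (i : Fin n), k ≤ i.1 → ‖geIter A k i ⟨k, hk⟩‖ ≤ pivotNorm A k

/-- A partially pivoted floating-point elimination trajectory for `A`, with unit round-off `u`.
`hatA k` is the floating-point iterate `Â^{(k+1)}` (0-indexed). -/
structure PPFloatTraj (n : ℕ) (u : ℝ) (A : Matrix (Fin n) (Fin n) ℝ) where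
  hatA : ℕ → Matrix (Fin n) (Fin n) ℝ
  s : Fin n → ℕ → ℝ
  φ0 : Matrix (Fin n) (Fin n) ℝ
  φ : ℕ → Matrix (Fin n) (Fin n) ℝ
  θ : ℕ → Matrix (Fin n) (Fin n) ℝ
  ψ : Fin n → ℕ → ℝ
  hφ0 : ∀ i j, |φ0 i j| ≤ u
  hφ : ∀ k i j, |φ k i j| ≤ u
  hθ : ∀ k i j, |θ k i j| ≤ u
  hψ : ∀ i k, |ψ i k| ≤ u
  init : ∀ i j, hatA 0 i j = A i j * (1 + φ0 i j)
  hs : ∀ (k : ℕ) (hk : k < n) (i : Fin n), k ≤ i.1 →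
    s i k = hatA k i ⟨k, hk⟩ / hatA k ⟨k, hk⟩ ⟨k, hk⟩ * (1 + ψ i k)
  step : ∀ (k : ℕ) (hk : k < n) (i j : Fin n), k + 1 ≤ i.1 → k + 1 ≤ j.1 →
    hatA (k + 1) i j = (hatA k i j - s i k * hatA k ⟨k, hk⟩ j * (1 + θ k i j)) * (1 + φ k i j)
  pivot_ne : ∀ (k : ℕ) (hk : k < n), hatA k ⟨k, hk⟩ ⟨k, hk⟩ ≠ 0
  piv : ∀ (k : ℕ) (hk : k < n) (i : Fin n), k ≤ i.1 →
    |hatA k i ⟨k, hk⟩| ≤ |hatA k ⟨k, hk⟩ ⟨k, hk⟩|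
  s_le : ∀ (k : ℕ) (i : Fin n), k < n → k ≤ i.1 → |s i k| ≤ 1
  sθ_le : ∀ (k : ℕ) (i j : Fin n), k < n → k ≤ i.1 → |s i k * (1 + θ k i j)| ≤ 1

/-- The entry `Â^{(ℓ+1)}_{ℓ,j}` of a trajectory (0 if `ℓ ≥ n`). -/
noncomputable def rowPivEntry {n : ℕ} (M : ℕ → Matrix (Fin n) (Fin n) ℝ) (ℓ : ℕ)
    (j : Fin n) : ℝ :=
  if h : ℓ < n then M ℓ ⟨ℓ, h⟩ j else 0

/-- The exact rank-one update at step `l`, cut off to the active block. -/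
noncomputable def updQ {n : ℕ} (M : ℕ → Matrix (Fin n) (Fin n) ℝ) (l : ℕ) (i j : Fin n) : ℝ :=
  if h : l < n ∧ l ≤ i.1 ∧ l ≤ j.1 then
    M l i ⟨l, h.1⟩ * M l ⟨l, h.1⟩ j / M l ⟨l, h.1⟩ ⟨l, h.1⟩ else 0

/-- The tail sums of the updates, which are the exact iterates of `tailC M 0`. -/
noncomputable def tailC {n : ℕ} (M : ℕ → Matrix (Fin n) (Fin n) ℝ) (k : ℕ) :
    Matrix (Fin n) (Fin n) ℝ :=
  fun i j => ∑ l ∈ Finset.Ico k n, updQ M l i j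

theorem tailC_step {n : ℕ} (M : ℕ → Matrix (Fin n) (Fin n) ℝ) (k : ℕ) (hk : k < n)
    (i j : Fin n) : tailC M k i j = updQ M k i j + tailC M (k + 1) i j := by
  unfold tailC
  exact Finset.sum_eq_sum_Ico_succ_bot hk _

theorem tailC_zero {n : ℕ} (M : ℕ → Matrix (Fin n) (Fin n) ℝ) (k : ℕ)
    (i j : Fin n) (h : i.1 < k ∨ j.1 < k) : tailC M k i j = 0 := by
  unfold tailC
  apply Finset.sum_eq_zero
  intro l hl
  rw [Finset.mem_Ico] at hl
  unfold updQ
  rw [dif_neg]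
  omega

theorem tailC_edge {n : ℕ} (M : ℕ → Matrix (Fin n) (Fin n) ℝ)
    (hM : ∀ (k : ℕ) (hk : k < n), M k ⟨k, hk⟩ ⟨k, hk⟩ ≠ 0) (k : ℕ)
    (i j : Fin n) (hi : k ≤ i.1) (hj : k ≤ j.1) (h : i.1 = k ∨ j.1 = k) :
    tailC M k i j = M k i j := by
  have hk : k < n := lt_of_le_of_lt hi i.2
  rw [tailC_step M k hk, tailC_zero M (k + 1) i j (by omega), add_zero]
  unfold updQ
  rw [dif_pos ⟨hk, hi, hj⟩]
  have := hM k hk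
  rcases h with h | h
  · have : i = ⟨k, hk⟩ := Fin.ext h
    subst this
    field_simp
  · have : j = ⟨k, hk⟩ := Fin.ext h
    subst this
    field_simp

theorem geIter_tailC {n : ℕ} (M : ℕ → Matrix (Fin n) (Fin n) ℝ)
    (hM : ∀ (k : ℕ) (hk : k < n), M k ⟨k, hk⟩ ⟨k, hk⟩ ≠ 0) (k : ℕ) :
    ∀ (i j : Fin n), k ≤ i.1 → k ≤ j.1 → geIter (tailC M 0) k i j = tailC M k i j := by
  induction k with
  | zero => intro i j _ _; rfl
  | succ k ih =>
    intro i j hi hj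
    have hk : k < n := by omega
    simp only [geIter]
    rw [dif_pos ⟨hk, hi, hj⟩, ih i j (by omega) (by omega), ih i ⟨k, hk⟩ (by omega) le_rfl,
      ih ⟨k, hk⟩ j le_rfl (by omega), ih ⟨k, hk⟩ ⟨k, hk⟩ le_rfl le_rfl,
      tailC_edge M hM k i ⟨k, hk⟩ (by omega) le_rfl (Or.inr rfl),
      tailC_edge M hM k ⟨k, hk⟩ j le_rfl (by omega) (Or.inl rfl),
      tailC_edge M hM k ⟨k, hk⟩ ⟨k, hk⟩ le_rfl le_rfl (Or.inl rfl),
      tailC_step M k hk]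
    unfold updQ
    rw [dif_pos ⟨hk, by omega, by omega⟩]
    ring

theorem tailC_det {n : ℕ} (M : ℕ → Matrix (Fin n) (Fin n) ℝ)
    (hM : ∀ (k : ℕ) (hk : k < n), M k ⟨k, hk⟩ ⟨k, hk⟩ ≠ 0) : (tailC M 0).det ≠ 0 := by
  let L : Matrix (Fin n) (Fin n) ℝ := fun i l => if l.1 ≤ i.1 then M l.1 i l / M l.1 l l else 0
  let U : Matrix (Fin n) (Fin n) ℝ := fun l j => if l.1 ≤ j.1 then M l.1 l j else 0
  have hLU : tailC M 0 = L * U := by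
    ext i j
    rw [Matrix.mul_apply]
    unfold tailC
    rw [← Finset.range_eq_Ico, ← Fin.sum_univ_eq_sum_range (fun l => updQ M l i j) n]
    refine Finset.sum_congr rfl fun l _ => ?_
    by_cases h1 : l ≤ i <;> by_cases h2 : l ≤ j <;> simp [updQ, L, U, h1, h2]
    ring
  rw [hLU, Matrix.det_mul]
  have hL : L.det = ∏ i, L i i := by
    apply Matrix.det_of_lowerTriangular
    intro i j hij
    have hij : i < j := hij
    simp [L, hij]
  have hU : U.det = ∏ i, U i i := by
    apply Matrix.det_of_upperTriangular
    intro i j hij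
    have hij : j < i := hij
    simp [U, hij]
  rw [hL, hU]
  apply mul_ne_zero <;> rw [Finset.prod_ne_zero_iff] <;> intro a _
  · simp [L, hM a.1 a.2]
  · simp [U, hM a.1 a.2]

theorem step_bound (u h p r s th ph ps : ℝ) (hu : 0 < u) (hth : |th| ≤ u) (hph : |ph| ≤ u)
    (hps : |ps| ≤ u) (hs : s = r * (1 + ps)) (hr : |r| ≤ 1) (hs1 : |s| ≤ 1)
    (hst : |s * (1 + th)| ≤ 1) :
    |h - (h - s * p * (1 + th)) * (1 + ph) - r * p| ≤ u * (|h| + |p| * (3 + u)) := by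
  have e : h - (h - s * p * (1 + th)) * (1 + ph) - r * p
      = -(h * ph) + (p * (s * (1 + th) * ph) + p * (r * ps + s * th)) := by
    subst hs; ring
  have b1 : |h * ph| ≤ |h| * u := by rw [abs_mul]; gcongr
  have b2 : |s * (1 + th) * ph| ≤ 1 * u := by rw [abs_mul]; gcongr
  have b3 : |r * ps| ≤ 1 * u := by rw [abs_mul]; gcongr
  have b4 : |s * th| ≤ 1 * u := by rw [abs_mul]; gcongr
  have b5 : |p * (s * (1 + th) * ph)| ≤ |p| * (1 * u) := by rw [abs_mul]; gcongr
  have b6 : |p * (r * ps + s * th)| ≤ |p| * (1 * u + 1 * u) := by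
    rw [abs_mul]; gcongr; exact (abs_add_le _ _).trans (add_le_add b3 b4)
  rw [e]
  have t1 := abs_add_le (-(h * ph)) (p * (s * (1 + th) * ph) + p * (r * ps + s * th))
  have t2 := abs_add_le (p * (s * (1 + th) * ph)) (p * (r * ps + s * th))
  rw [abs_neg] at t1
  have : 0 ≤ |p| * (u * u) := by positivity
  nlinarith

theorem traj_bound {n : ℕ} (u : ℝ) (hu : 0 < u)
    (A : Matrix (Fin n) (Fin n) ℝ) (T : PPFloatTraj n u A) (i j : Fin n) (d : ℕ) :
    ∀ k : ℕ, k + d = min i.1 j.1 →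
        |T.hatA k i j - tailC T.hatA k i j| ≤
          u * ∑ ℓ ∈ Finset.Ico k (min i.1 j.1),
            (|T.hatA ℓ i j| + |rowPivEntry T.hatA ℓ j| * (3 + u)) := by
  induction d with
  | zero =>
    intro k hk
    rw [tailC_edge T.hatA T.pivot_ne k i j (by omega) (by omega) (by omega)]
    simp [← hk]
  | succ d ih =>
    intro k hk
    have hkn : k < n := by omega
    have := ih (k + 1) (by omega)
    rw [Finset.sum_eq_sum_Ico_succ_bot (by omega : k < min i.1 j.1), mul_add,
      tailC_step _ k hkn]
    have hb := step_bound u (T.hatA k i j) (T.hatA k ⟨k, hkn⟩ j)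
      (T.hatA k i ⟨k, hkn⟩ / T.hatA k ⟨k, hkn⟩ ⟨k, hkn⟩) (T.s i k) (T.θ k i j) (T.φ k i j)
      (T.ψ i k) hu (T.hθ _ _ _) (T.hφ _ _ _) (T.hψ _ _) (T.hs k hkn i (by omega))
      (by rw [abs_div]; exact div_le_one_of_le₀ (T.piv k hkn i (by omega)) (abs_nonneg _))
      (T.s_le k i hkn (by omega)) (T.sθ_le k i j hkn (by omega))
    rw [← T.step k hkn i j (by omega) (by omega)] at hb
    have e1 : rowPivEntry T.hatA k j = T.hatA k ⟨k, hkn⟩ j := by simp [rowPivEntry, hkn]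
    have e2 : updQ T.hatA k i j = T.hatA k i ⟨k, hkn⟩ / T.hatA k ⟨k, hkn⟩ ⟨k, hkn⟩ *
        T.hatA k ⟨k, hkn⟩ j := by
      unfold updQ
      rw [dif_pos ⟨hkn, by omega, by omega⟩]
      ring
    rw [e1, e2]
    refine le_trans ?_ (add_le_add hb this)
    refine le_trans (le_of_eq ?_) (abs_add_le _ _)
    congr 1
    ring

/-- every partially pivoted floating-point trajectory is the exact
trajectory of a nearby partially pivoted matrix. -/
theorem float_pp_backward {n : ℕ} (u : ℝ) (hu : 0 < u)
    (A : Matrix (Fin n) (Fin n) ℝ) (T : PPFloatTraj n u A) :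
    ∃ B : Matrix (Fin n) (Fin n) ℝ, IsPP B ∧
      (∀ (k : ℕ) (i j : Fin n), k ≤ i.1 → k ≤ j.1 → (i.1 = k ∨ j.1 = k) →
        geIter B k i j = T.hatA k i j) ∧
      ∀ (k : ℕ) (i j : Fin n), k ≤ i.1 → k ≤ j.1 →
        |T.hatA k i j - geIter B k i j| ≤
          u * ∑ ℓ ∈ Finset.Ico k (min i.1 j.1),
            (|T.hatA ℓ i j| + |rowPivEntry T.hatA ℓ j| * (3 + u)) := by
  have hE : ∀ (k : ℕ) (i j : Fin n), k ≤ i.1 → k ≤ j.1 → (i.1 = k ∨ j.1 = k) →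
      geIter (tailC T.hatA 0) k i j = T.hatA k i j := by
    intro k i j hi hj h
    rw [geIter_tailC _ T.pivot_ne k i j hi hj, tailC_edge _ T.pivot_ne k i j hi hj h]
  have hP : ∀ (k : ℕ) (hk : k < n),
      pivotNorm (tailC T.hatA 0) k = |T.hatA k ⟨k, hk⟩ ⟨k, hk⟩| := by
    intro k hk
    unfold pivotNorm
    rw [dif_pos hk, hE k ⟨k, hk⟩ ⟨k, hk⟩ le_rfl le_rfl (Or.inl rfl), Real.norm_eq_abs]
  refine ⟨tailC T.hatA 0, ⟨tailC_det _ T.pivot_ne, ?_, ?_⟩, hE, ?_⟩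
  · intro k hk
    rw [hP k (by omega)]
    exact abs_ne_zero.mpr (T.pivot_ne k (by omega))
  · intro k hk i hi
    rw [hP k hk, hE k i ⟨k, hk⟩ hi le_rfl (Or.inr rfl), Real.norm_eq_abs]
    exact T.piv k hk i hi
  · intro k i j hi hj
    rw [geIter_tailC _ T.pivot_ne k i j hi hj]
    exact traj_bound u hu A T i j (min i.1 j.1 - k) k (by omega)
end

section
/- Let 𝕜 be ℝ or ℂ and let ε = (ε_1,…,ε_{n−1}) with ε_i ≥ 0 for i = 1,…,n−1. Then for every A ∈ RP^ε_n(𝕜) there exists a matrix B ∈ RP_n(𝕜) such that a^{(k)}_{n,n} = b^{(k)}_{n,n} for all k = 1,…,n, and |a^{(k)}_{i,j} − b^{(k)}_{i,j}| ≤ (2 + ε_ℓ)·ε_ℓ·|a^{(ℓ)}_{ℓ,ℓ}| with ℓ := min(i,j), for all i,j = k,…,n and k = 1,…,n−1. -/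
open scoped BigOperators

/-- `A` is rook pivoted: `A ∈ RP_n(𝕜)`. -/
def IsRP {𝕜 : Type*} [RCLike 𝕜] {n : ℕ} (A : Matrix (Fin n) (Fin n) 𝕜) : Prop :=
  A.det ≠ 0 ∧ (∀ k : ℕ, k + 1 < n → pivotNorm A k ≠ 0) ∧
    ∀ (k : ℕ) (hk : k < n) (i : Fin n), k ≤ i.1 →
      ‖geIter A k i ⟨k, hk⟩‖ ≤ pivotNorm A k ∧ ‖geIter A k ⟨k, hk⟩ i‖ ≤ pivotNorm A k

/-- `g[RP_n(𝕜)]`. -/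
noncomputable def gRP (𝕜 : Type*) [RCLike 𝕜] (n : ℕ) : ℝ :=
  sSup (growth '' {A : Matrix (Fin n) (Fin n) 𝕜 | IsRP A})

/-- `A ∈ RP^ε_n(𝕜)`: almost rook pivoted with tolerance `ε k` at step `k`
(0-indexed, so `ε 0` is the paper's `ε_1`). -/
def IsRPeps {𝕜 : Type*} [RCLike 𝕜] {n : ℕ} (ε : ℕ → ℝ)
    (A : Matrix (Fin n) (Fin n) 𝕜) : Prop :=
  A.det ≠ 0 ∧ (∀ k : ℕ, k + 1 < n → pivotNorm A k ≠ 0) ∧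
    ∀ (k : ℕ) (hk : k < n) (i : Fin n), k ≤ i.1 →
      ‖geIter A k i ⟨k, hk⟩‖ ≤ (1 + ε k) * pivotNorm A k ∧
        ‖geIter A k ⟨k, hk⟩ i‖ ≤ (1 + ε k) * pivotNorm A k

theorem geIter_succ_of {𝕜 : Type*} [Field 𝕜] {n : ℕ} (A : Matrix (Fin n) (Fin n) 𝕜) (k : ℕ)
    (hk : k < n) (i j : Fin n) (hi : k + 1 ≤ i.1) (hj : k + 1 ≤ j.1) :
    geIter A (k + 1) i j = geIter A k i j -
        geIter A k i ⟨k, hk⟩ * geIter A k ⟨k, hk⟩ j / geIter A k ⟨k, hk⟩ ⟨k, hk⟩ := by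
  exact dif_pos ⟨hk, hi, hj⟩

theorem ge_sum {𝕜 : Type*} [Field 𝕜] {n : ℕ} (A : Matrix (Fin n) (Fin n) 𝕜) (i j : Fin n) (k : ℕ)
    (hi : k ≤ i.1) (hj : k ≤ j.1) :
    A i j = (∑ m : Fin n, if m.1 < k then
      geIter A m.1 i m * geIter A m.1 m j / geIter A m.1 m m else 0) + geIter A k i j := by
  induction k with
  | zero => simp [geIter]
  | succ k ih =>
    have hk : k < n := by omega
    rw [geIter_succ_of A k hk i j hi hj]
    have h1 : ∀ m : Fin n, (if m.1 < k + 1 then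
        geIter A m.1 i m * geIter A m.1 m j / geIter A m.1 m m else 0) =
        (if m.1 < k then
        geIter A m.1 i m * geIter A m.1 m j / geIter A m.1 m m else 0) +
        (if m = (⟨k, hk⟩ : Fin n) then
        geIter A m.1 i m * geIter A m.1 m j / geIter A m.1 m m else 0) := by
      intro m
      rcases lt_trichotomy m.1 k with h | h | h
      · have : m ≠ (⟨k, hk⟩ : Fin n) := fun e => by rw [e] at h; simp at h
        simp [h, this, Nat.lt_succ_of_lt h]
      · have : m = (⟨k, hk⟩ : Fin n) := Fin.ext h
        simp [this]
      · have h2 : m ≠ (⟨k, hk⟩ : Fin n) := fun e => by rw [e] at h; simp at h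
        have h3 : ¬ m.1 < k + 1 := by omega
        have h4 : ¬ m.1 < k := by omega
        rw [if_neg h2, if_neg h3, if_neg h4, add_zero]
    rw [Finset.sum_congr rfl (fun m _ => h1 m), Finset.sum_add_distrib,
      Finset.sum_ite_eq' Finset.univ, if_pos (Finset.mem_univ _)]
    rw [ih (by omega) (by omega)]
    ring

theorem ge_det {𝕜 : Type*} [Field 𝕜] {n : ℕ} (A : Matrix (Fin n) (Fin n) 𝕜)
    (h : ∀ m : Fin n, m.1 + 1 < n → geIter A m.1 m m ≠ 0) :
    A.det = ∏ m : Fin n, geIter A m.1 m m := by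
  let L : Matrix (Fin n) (Fin n) 𝕜 := fun i m =>
    if i = m then 1 else if m < i then geIter A m.1 i m / geIter A m.1 m m else 0
  let U : Matrix (Fin n) (Fin n) 𝕜 := fun m j => if m ≤ j then geIter A m.1 m j else 0
  have hLU : A = L * U := by
    ext i j
    rw [Matrix.mul_apply]
    have key := ge_sum A i j (min i j).1 (by simp [Fin.coe_min]) (by simp [Fin.coe_min])
    have h1 : ∀ m : Fin n, L i m * U m j = (if m.1 < (min i j).1 then
        geIter A m.1 i m * geIter A m.1 m j / geIter A m.1 m m else 0) +
        (if m = min i j then geIter A (min i j).1 i j else 0) := by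
      intro m
      simp only [L, U]
      rcases lt_trichotomy m (min i j) with hm | hm | hm
      · have hi : m < i := lt_of_lt_of_le hm (min_le_left _ _)
        have hj : m < j := lt_of_lt_of_le hm (min_le_right _ _)
        rw [if_neg hi.ne', if_pos hi, if_pos hj.le, if_pos (Fin.lt_def.1 hm), if_neg hm.ne]
        ring
      · have hlt : ¬ m.1 < (min i j).1 := by rw [hm]; exact lt_irrefl _
        rw [if_neg hlt, if_pos hm, zero_add]
        rcases le_or_gt i j with hij | hij
        · rw [min_eq_left hij] at hm ⊢
          subst hm
          rw [if_pos rfl, if_pos hij, one_mul]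
        · rw [min_eq_right hij.le] at hm ⊢
          subst hm
          rw [if_neg hij.ne', if_pos hij, if_pos le_rfl]
          have := h m (by have := i.2; have := Fin.lt_def.1 hij; omega)
          field_simp
      · have hlt : ¬ m.1 < (min i j).1 := Nat.not_lt.2 (Fin.lt_def.1 hm).le
        rw [if_neg hlt, if_neg hm.ne', zero_add]
        rcases min_lt_iff.1 hm with h' | h'
        · rw [if_neg h'.ne, if_neg h'.not_gt, zero_mul]
        · rw [if_neg h'.not_ge, mul_zero]
    rw [Finset.sum_congr rfl (fun m _ => h1 m), Finset.sum_add_distrib,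
      Finset.sum_ite_eq' Finset.univ, if_pos (Finset.mem_univ _)]
    exact key
  have hL : L.det = 1 := by
    rw [Matrix.det_of_isLowerTriangular]
    · simp [L]
    · intro i j hij
      have hij' : i < j := hij
      simp [L, hij'.ne, hij'.not_gt]
  have hU : U.det = ∏ m : Fin n, geIter A m.1 m m := by
    rw [Matrix.det_of_isUpperTriangular]
    · simp [U]
    · intro i j hij
      have hij' : j < i := hij
      simp [U, hij'.not_ge]
  rw [← hU, hLU, Matrix.det_mul, hL, one_mul]

/-- rook pivoting stability lemma.  (0-indexed; the paper's
`ℓ = min(i,j)` corresponds to `min i.1 j.1` here.) -/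
theorem rp_eps_stable {𝕜 : Type*} [RCLike 𝕜] {n : ℕ} (hn : 1 ≤ n)
    (ε : ℕ → ℝ) (hε : ∀ i, i + 1 < n → 0 ≤ ε i)
    (A : Matrix (Fin n) (Fin n) 𝕜) (hA : IsRPeps ε A) :
    ∃ B : Matrix (Fin n) (Fin n) 𝕜, IsRP B ∧
      (∀ k : ℕ, k < n →
        geIter A k ⟨n - 1, by omega⟩ ⟨n - 1, by omega⟩ =
          geIter B k ⟨n - 1, by omega⟩ ⟨n - 1, by omega⟩) ∧
      ∀ (k : ℕ) (i j : Fin n), k ≤ i.1 → k ≤ j.1 →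
        ‖geIter A k i j - geIter B k i j‖ ≤
          (2 + ε (min i.1 j.1)) * ε (min i.1 j.1) * pivotNorm A (min i.1 j.1) := by
  obtain ⟨hdet, hpiv, hbd⟩ := hA
  have pn : ∀ (M : Matrix (Fin n) (Fin n) 𝕜) (m : Fin n),
      pivotNorm M m.1 = ‖geIter M m.1 m m‖ := by
    intro M m
    rw [pivotNorm, dif_pos m.2]
  have hp0 : ∀ m : Fin n, m.1 + 1 < n → geIter A m.1 m m ≠ 0 := by
    intro m hm h0
    apply hpiv m.1 hm
    rw [pn, h0, norm_zero]
  have hp : ∀ m : Fin n, geIter A m.1 m m ≠ 0 := by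
    rw [ge_det A hp0] at hdet
    intro m
    exact Finset.prod_ne_zero_iff.1 hdet m (Finset.mem_univ _)
  have hε' : ∀ m : Fin n, 0 ≤ ε m.1 := by
    intro m
    have h1 := (hbd m.1 m.2 m le_rfl).1
    rw [pn] at h1
    have h2 : 0 < ‖geIter A m.1 m m‖ := norm_pos_iff.2 (hp m)
    change ‖geIter A m.1 m m‖ ≤ _ at h1
    by_contra h
    push Not at h
    nlinarith
  let s : Fin n → ℝ := fun m => if m.1 + 1 < n then 1 + ε m.1 else 1
  have hs1 : ∀ m, 1 ≤ s m := by
    intro m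
    have := hε' m
    simp only [s]
    split_ifs <;> linarith
  have hs2 : ∀ m, s m ≤ 1 + ε m.1 := by
    intro m
    have := hε' m
    simp only [s]
    split_ifs <;> linarith
  let f : Fin n → Fin n → ℝ := fun i j => if i = j then s i ^ 2 else s (min i j)
  let B : Matrix (Fin n) (Fin n) 𝕜 := fun i j =>
    A i j + ((f i j - 1 : ℝ) : 𝕜) * geIter A (min i j).1 i j
  have hB : ∀ (k : ℕ) (i j : Fin n), k ≤ i.1 → k ≤ j.1 →
      geIter B k i j = geIter A k i j + ((f i j - 1 : ℝ) : 𝕜) * geIter A (min i j).1 i j := by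
    intro k
    induction k with
    | zero => intro i j _ _; rfl
    | succ k ih =>
      intro i j hi hj
      have hk : k < n := by omega
      have hki : (⟨k, hk⟩ : Fin n) < i := Fin.lt_def.2 hi
      have hkj : (⟨k, hk⟩ : Fin n) < j := Fin.lt_def.2 hj
      rw [geIter_succ_of B k hk i j hi hj, geIter_succ_of A k hk i j hi hj,
        ih i j (by omega) (by omega), ih i ⟨k, hk⟩ (by omega) le_rfl,
        ih ⟨k, hk⟩ j le_rfl (by omega), ih ⟨k, hk⟩ ⟨k, hk⟩ le_rfl le_rfl]
      have f1 : f i ⟨k, hk⟩ = s ⟨k, hk⟩ := by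
        simp only [f]; rw [if_neg hki.ne', min_eq_right hki.le]
      have f2 : f ⟨k, hk⟩ j = s ⟨k, hk⟩ := by
        simp only [f]; rw [if_neg hkj.ne, min_eq_left hkj.le]
      have f3 : f ⟨k, hk⟩ ⟨k, hk⟩ = s ⟨k, hk⟩ ^ 2 := by simp [f]
      rw [f1, f2, f3, min_eq_right hki.le, min_eq_left hkj.le, min_self]
      have hpk : geIter A k ⟨k, hk⟩ ⟨k, hk⟩ ≠ 0 := hp ⟨k, hk⟩
      have hsk : ((s ⟨k, hk⟩ : ℝ) : 𝕜) ≠ 0 := by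
        have := hs1 ⟨k, hk⟩
        exact_mod_cast (by linarith : s ⟨k, hk⟩ ≠ 0)
      have alg : ∀ (x c r p y σ : 𝕜), σ ≠ 0 → p ≠ 0 →
          x + y - (c + (σ - 1) * c) * (r + (σ - 1) * r) / (p + (σ ^ 2 - 1) * p) =
          x - c * r / p + y := by
        intro x c r p y σ hσ hp
        have e1 : ∀ x : 𝕜, x + (σ - 1) * x = σ * x := fun x => by ring
        have e2 : p + (σ ^ 2 - 1) * p = σ ^ 2 * p := by ring
        rw [e1, e1, e2]
        field_simp
        ring
      have c1 : ((s ⟨k, hk⟩ - 1 : ℝ) : 𝕜) = ((s ⟨k, hk⟩ : ℝ) : 𝕜) - 1 := by push_cast; rfl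
      have c2 : ((s ⟨k, hk⟩ ^ 2 - 1 : ℝ) : 𝕜) = ((s ⟨k, hk⟩ : ℝ) : 𝕜) ^ 2 - 1 := by
        push_cast; rfl
      rw [c1, c2]
      exact alg _ _ _ _ _ _ hsk hpk
  have hBm : ∀ i j : Fin n, geIter B (min i j).1 i j =
      ((f i j : ℝ) : 𝕜) * geIter A (min i j).1 i j := by
    intro i j
    rw [hB _ i j (by simp [Fin.coe_min]) (by simp [Fin.coe_min])]
    push_cast
    ring
  have hBp : ∀ m : Fin n, geIter B m.1 m m = ((s m ^ 2 : ℝ) : 𝕜) * geIter A m.1 m m := by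
    intro m
    have := hBm m m
    simpa only [min_self, f, if_true] using this
  have hBp0 : ∀ m : Fin n, geIter B m.1 m m ≠ 0 := by
    intro m
    rw [hBp]
    have := hs1 m
    have h2 : s m ^ 2 ≠ 0 := by positivity
    exact mul_ne_zero (by exact_mod_cast h2) (hp m)
  have hBpn : ∀ m : Fin n, pivotNorm B m.1 = s m ^ 2 * pivotNorm A m.1 := by
    intro m
    rw [pn, pn, hBp, norm_mul, RCLike.norm_ofReal, abs_of_nonneg (sq_nonneg _)]
  have hpnA : ∀ m : Fin n, 0 ≤ pivotNorm A m.1 := fun m => by rw [pn]; exact norm_nonneg _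
  refine ⟨B, ⟨?_, ?_, ?_⟩, ?_, ?_⟩
  · rw [ge_det B (fun m _ => hBp0 m)]
    exact Finset.prod_ne_zero_iff.2 fun m _ => hBp0 m
  · intro k hk
    have := pn B ⟨k, by omega⟩
    simp only at this
    rw [this]
    exact norm_ne_zero_iff.2 (hBp0 ⟨k, by omega⟩)
  · intro k hk i hi
    rcases eq_or_lt_of_le hi with he | hlt
    · have : i = ⟨k, hk⟩ := Fin.ext he.symm
      subst this
      have := pn B ⟨k, hk⟩
      simp only at this
      rw [this]
      exact ⟨le_rfl, le_rfl⟩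
    · have hki : (⟨k, hk⟩ : Fin n) < i := Fin.lt_def.2 hlt
      have h1 := hBm i ⟨k, hk⟩
      have h2 := hBm ⟨k, hk⟩ i
      have f1 : f i ⟨k, hk⟩ = s ⟨k, hk⟩ := by
        simp only [f]; rw [if_neg hki.ne', min_eq_right hki.le]
      have f2 : f ⟨k, hk⟩ i = s ⟨k, hk⟩ := by
        simp only [f]; rw [if_neg hki.ne, min_eq_left hki.le]
      rw [min_eq_right hki.le, f1] at h1
      rw [min_eq_left hki.le, f2] at h2
      have hq := hBpn ⟨k, hk⟩
      have hs : s ⟨k, hk⟩ = 1 + ε k := by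
        simp only [s]; rw [if_pos (by have := i.2; omega)]
      have hsp := hs1 ⟨k, hk⟩
      simp only at h1 h2 hq
      obtain ⟨b1, b2⟩ := hbd k hk i hi
      rw [h1, h2, hq, norm_mul, norm_mul, RCLike.norm_ofReal, abs_of_nonneg (by linarith), sq,
        mul_assoc]
      rw [← hs] at b1 b2
      exact ⟨mul_le_mul_of_nonneg_left b1 (by linarith), mul_le_mul_of_nonneg_left b2 (by linarith)⟩
  · intro k hk
    rw [hB k _ _ (by simp only; omega) (by simp only; omega)]
    have : f ⟨n - 1, by omega⟩ ⟨n - 1, by omega⟩ = 1 := by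
      simp only [f, s, if_true]
      rw [if_neg (by omega), one_pow]
    rw [this]
    simp
  · intro k i j hi hj
    rw [hB k i j hi hj, sub_add_cancel_left, norm_neg, norm_mul, RCLike.norm_ofReal]
    have hmin : min i.1 j.1 = (min i j).1 := by simp [Fin.coe_min]
    rw [hmin]
    have he := hε' (min i j)
    have hP := hpnA (min i j)
    by_cases hij : i = j
    · subst hij
      have hf : f i i = s i ^ 2 := by simp [f]
      rw [hf, min_self] at *
      have h1 := hs1 i
      have h2 := hs2 i
      rw [abs_of_nonneg (by nlinarith), ← pn]
      exact mul_le_mul_of_nonneg_right (by nlinarith) hP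
    · have hf : f i j = s (min i j) := by simp [f, hij]
      rw [hf]
      have h1 := hs1 (min i j)
      have h2 := hs2 (min i j)
      have hb : ‖geIter A (min i j).1 i j‖ ≤ (1 + ε (min i j).1) * pivotNorm A (min i j).1 := by
        rcases le_total i j with h | h
        · rw [min_eq_left h]
          exact (hbd i.1 i.2 j h).2
        · rw [min_eq_right h]
          exact (hbd j.1 j.2 i h).1
      rw [abs_of_nonneg (by linarith)]
      calc (s (min i j) - 1) * ‖geIter A (min i j).1 i j‖
          ≤ ε (min i j).1 * ((1 + ε (min i j).1) * pivotNorm A (min i j).1) :=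
            mul_le_mul (by linarith) hb (norm_nonneg _) he
        _ ≤ _ := by
          have := mul_nonneg he hP
          nlinarith
end
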